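/- arXiv:1206.3971 — 2 statements merged into one kernel-verified Lean document; each statement's English description precedes it below -/
import Mathlib

section
/- Let (u_p)_{p>1} be a family of nodal solutions of (𝒫_p) satisfying condition (A). Then there exist C > 0 and p̄ > 1 such that sup_{x ∈ Ω} |u_p(x)| ≤ C for all p ≥ p̄. -/
open MeasureTheory Real Set Filter Topology Metric

noncomputable section

/-- The Euclidean plane. -/
abbrev R2 : Type := EuclideanSpace ℝ (Fin 2)

/-- The Laplacian: sum of the two pure second directional derivatives. -/
def lap (u : R2 → ℝ) (x : R2) : ℝ :=
  ∑ i : Fin 2,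
    fderiv ℝ (fun y => fderiv ℝ u y (EuclideanSpace.single i 1)) x (EuclideanSpace.single i 1)

/-- Each point of ∂Ω has a neighborhood in which ∂Ω is the graph of a C^∞ function
(in suitable Euclidean coordinates). -/
def SmoothBoundary (Ω : Set R2) : Prop :=
  ∀ x ∈ frontier Ω, ∃ V : Set R2, IsOpen V ∧ x ∈ V ∧
    ∃ (e : R2 ≃ᵢ R2) (g : ℝ → ℝ), ContDiff ℝ (⊤ : ℕ∞) g ∧
      frontier Ω ∩ V = {y | y ∈ V ∧ e y 1 = g (e y 0)}

/-- A (classical) solution of the Lane–Emden problem `(𝒫_p)` on Ω. -/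
def IsSolution (Ω : Set R2) (p : ℝ) (u : R2 → ℝ) : Prop :=
  ContDiffOn ℝ 2 u Ω ∧ ContDiffOn ℝ 1 u (closure Ω) ∧
  (∀ x ∈ Ω, -lap u x = |u x| ^ (p - 1) * u x) ∧
  (∀ x ∈ frontier Ω, u x = 0)

/-- A nodal (sign-changing) function on Ω. -/
def IsNodal (Ω : Set R2) (u : R2 → ℝ) : Prop :=
  (∃ x ∈ Ω, 0 < u x) ∧ ∃ x ∈ Ω, u x < 0

/-- The energy functional E_p. -/
def energy (Ω : Set R2) (p : ℝ) (u : R2 → ℝ) : ℝ :=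
  (1 / 2) * ∫ x in Ω, ‖gradient u x‖ ^ 2 - (1 / (p + 1)) * ∫ x in Ω, |u x| ^ (p + 1)

/-- Condition (A): p·∫_Ω |∇u_p|² → 16πe. -/
def CondA (Ω : Set R2) (u : ℝ → R2 → ℝ) : Prop :=
  Tendsto (fun p : ℝ => p * ∫ x in Ω, ‖gradient (u p) x‖ ^ 2) atTop
    (𝓝 (16 * π * Real.exp 1))

/-- Condition (B): p·(u_p(x_p⁺) + u_p(x_p⁻)) → K for some K ≥ 0. -/
def CondB (u : ℝ → R2 → ℝ) (xp xm : ℝ → R2) : Prop :=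
  ∃ K : ℝ, 0 ≤ K ∧ Tendsto (fun p : ℝ => p * (u p (xp p) + u p (xm p))) atTop (𝓝 K)

/-- ε_p := (p·u_p(x_p⁺)^{p−1})^{−1/2}. -/
def eps (u : ℝ → R2 → ℝ) (xp : ℝ → R2) (p : ℝ) : ℝ :=
  1 / Real.sqrt (p * u p (xp p) ^ (p - 1))

/-- The rescaling z_p of u_p around x_p⁺. -/
def zp (u : ℝ → R2 → ℝ) (xp : ℝ → R2) (p : ℝ) (x : R2) : ℝ :=
  (p / u p (xp p)) * (u p (eps u xp p • x + xp p) - u p (xp p))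

/-- The rescaling z_p⁻ of u_p around x_p⁻ (with the scale ε_p of the maximum). -/
def zm (u : ℝ → R2 → ℝ) (xp xm : ℝ → R2) (p : ℝ) (x : R2) : ℝ :=
  (p / u p (xp p)) * (-u p (eps u xp p • x + xm p) - u p (xp p))

/-- Convergence in C²_loc(ℝ²) of a family of functions f_i defined on sets D_i:
every compact set K is eventually contained in D_i, and on K all derivatives up to
order 2 converge uniformly. -/
def TendstoC2loc {ι : Type} (l : Filter ι) (D : ι → Set R2) (f : ι → R2 → ℝ)
    (g : R2 → ℝ) : Prop :=
  ∀ K : Set R2, IsCompact K →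
    (∀ᶠ i in l, K ⊆ D i) ∧
    ∀ n : ℕ, n ≤ 2 →
      TendstoUniformlyOn (fun i x => iteratedFDeriv ℝ n (f i) x)
        (fun x => iteratedFDeriv ℝ n g x) l K

/-- The standard bubble U(x) = −2 log(1 + |x|²/8). -/
def stdBubble (x : R2) : ℝ := -2 * Real.log (1 + ‖x‖ ^ 2 / 8)

/-- The bubble U_μ(x) = log(μ/(1 + μ|x|²/8)²). -/
def bubble (μ : ℝ) (x : R2) : ℝ := Real.log (μ / (1 + μ * ‖x‖ ^ 2 / 8) ^ 2)

/-- A C^∞ function compactly supported in S. -/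
def CcSmoothIn (S : Set R2) (v : R2 → ℝ) : Prop :=
  ContDiff ℝ (⊤ : ℕ∞) v ∧ HasCompactSupport v ∧ tsupport v ⊆ S

/-- The quadratic form of the linearized operator at u. -/
def Qform (p : ℝ) (u v : R2 → ℝ) : ℝ :=
  ∫ x, (‖gradient v x‖ ^ 2 - p * |u x| ^ (p - 1) * v x ^ 2)

/-- Morse index one hypothesis (M): for p large, the quadratic form of the linearized
operator is negative somewhere on C_c^∞ of the positive nodal domain, but is not
negative definite on any 2-dimensional subspace. -/
def MorseOne (Ω : Set R2) (u : ℝ → R2 → ℝ) : Prop :=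
  ∀ᶠ p : ℝ in atTop,
    (∃ v : R2 → ℝ, CcSmoothIn {x ∈ Ω | 0 < u p x} v ∧ Qform p (u p) v < 0) ∧
    ¬ ∃ v w : R2 → ℝ, CcSmoothIn {x ∈ Ω | 0 < u p x} v ∧
        CcSmoothIn {x ∈ Ω | 0 < u p x} w ∧
        LinearIndependent ℝ ![v, w] ∧
        ∀ a b : ℝ, ¬(a = 0 ∧ b = 0) →
          Qform p (u p) (fun x => a * v x + b * w x) < 0


lemma lap_apply (u : R2 → ℝ) (x : R2) :
    lap u x = ∑ i : Fin 2, fderiv ℝ (fun y => fderiv ℝ u y (EuclideanSpace.single i 1)) x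
      (EuclideanSpace.single i 1) := rfl

lemma lap_congr {u v : R2 → ℝ} {x : R2} (h : u =ᶠ[𝓝 x] v) : lap u x = lap v x := by
  refine Finset.sum_congr rfl fun i _ => ?_
  have h' : (fun y => fderiv ℝ u y (EuclideanSpace.single i 1)) =ᶠ[𝓝 x]
      fun y => fderiv ℝ v y (EuclideanSpace.single i 1) := by
    filter_upwards [h.fderiv (𝕜 := ℝ)] with y hy
    rw [hy]
  rw [h'.fderiv_eq]

lemma lap_neg (u : R2 → ℝ) (x : R2) : lap (fun y => -u y) x = -lap u x := by
  simp [lap, fderiv_fun_neg, add_comm]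

lemma sum_fderiv_single_sq (u : R2 → ℝ) (x : R2) :
    ∑ i : Fin 2, fderiv ℝ u x (EuclideanSpace.single i 1) ^ 2 = ‖gradient u x‖ ^ 2 := by
  rw [EuclideanSpace.norm_sq_eq]
  refine Finset.sum_congr rfl fun i _ => ?_
  have h : fderiv ℝ u x = InnerProductSpace.toDual ℝ R2 (gradient u x) := by
    simp [gradient]
  rw [h, InnerProductSpace.toDual_apply_apply, EuclideanSpace.inner_single_right]
  simp

lemma norm_gradient_eq (u : R2 → ℝ) (x : R2) : ‖gradient u x‖ = ‖fderiv ℝ u x‖ := by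
  simp [gradient]

lemma contDiff_fderiv_apply {v : R2 → ℝ} (hv : ContDiff ℝ 2 v) (w : R2) :
    ContDiff ℝ 1 (fun y => fderiv ℝ v y w) :=
  (hv.fderiv_right (m := 1) (by norm_num)).clm_apply contDiff_const

lemma continuous_lap {v : R2 → ℝ} (hv : ContDiff ℝ 2 v) : Continuous (lap v) := by
  refine continuous_finsetSum _ fun i _ => ?_
  exact ((contDiff_fderiv_apply hv _).continuous_fderiv (by norm_num)).clm_apply continuous_const

/-- Green's second identity on the plane for a compactly supported factor. -/
lemma integral_mul_lap {L v : R2 → ℝ} (hL : ContDiff ℝ 2 L) (hv : ContDiff ℝ 2 v)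
    (hc : HasCompactSupport v) : ∫ x, L x * lap v x = ∫ x, lap L x * v x := by
  have key : ∀ i : Fin 2,
      ∫ x, L x * fderiv ℝ (fun y => fderiv ℝ v y (EuclideanSpace.single i 1)) x
        (EuclideanSpace.single i 1) =
      ∫ x, fderiv ℝ (fun y => fderiv ℝ L y (EuclideanSpace.single i 1)) x
        (EuclideanSpace.single i 1) * v x := by
    intro i
    set e : R2 := EuclideanSpace.single i 1
    have hL1 := contDiff_fderiv_apply hL e
    have hv1 := contDiff_fderiv_apply hv e
    have hc1 : HasCompactSupport (fun y => fderiv ℝ v y e) := hc.fderiv_apply ℝ e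
    have hc2 : HasCompactSupport (fun y => fderiv ℝ (fun y => fderiv ℝ v y e) y e) :=
      hc1.fderiv_apply ℝ e
    have hL2c : Continuous (fun y => fderiv ℝ (fun y => fderiv ℝ L y e) y e) :=
      (hL1.continuous_fderiv (by norm_num)).clm_apply continuous_const
    have hv2c : Continuous (fun y => fderiv ℝ (fun y => fderiv ℝ v y e) y e) :=
      (hv1.continuous_fderiv (by norm_num)).clm_apply continuous_const
    have I1 : Integrable fun x => fderiv ℝ L x e * fderiv ℝ v x e :=
      (hL1.continuous.mul hv1.continuous).integrable_of_hasCompactSupport hc1.mul_left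
    rw [integral_mul_fderiv_eq_neg_fderiv_mul_of_integrable I1
      ((hL.continuous.mul hv2c).integrable_of_hasCompactSupport hc2.mul_left)
      ((hL.continuous.mul hv1.continuous).integrable_of_hasCompactSupport hc1.mul_left)
      (fun x _ => (hL.differentiable (by norm_num)) x)
      (fun x _ => (hv1.differentiable (by norm_num)) x)]
    rw [integral_mul_fderiv_eq_neg_fderiv_mul_of_integrable
      ((hL2c.mul hv.continuous).integrable_of_hasCompactSupport hc.mul_left) I1
      ((hL1.continuous.mul hv.continuous).integrable_of_hasCompactSupport hc.mul_left)
      (fun x _ => (hL1.differentiable (by norm_num)) x)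
      (fun x _ => (hv.differentiable (by norm_num)) x), neg_neg]
  have int1 : ∀ i : Fin 2, Integrable fun x =>
      L x * fderiv ℝ (fun y => fderiv ℝ v y (EuclideanSpace.single i 1)) x
        (EuclideanSpace.single i 1) := fun i =>
    (hL.continuous.mul (((contDiff_fderiv_apply hv _).continuous_fderiv
      (by norm_num)).clm_apply continuous_const)).integrable_of_hasCompactSupport
      ((hc.fderiv_apply ℝ _).fderiv_apply ℝ _).mul_left
  have int2 : ∀ i : Fin 2, Integrable fun x =>
      fderiv ℝ (fun y => fderiv ℝ L y (EuclideanSpace.single i 1)) x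
        (EuclideanSpace.single i 1) * v x := fun i =>
    ((((contDiff_fderiv_apply hL _).continuous_fderiv
      (by norm_num)).clm_apply continuous_const).mul
      hv.continuous).integrable_of_hasCompactSupport hc.mul_left
  simp only [lap_apply, Finset.mul_sum, Finset.sum_mul]
  rw [integral_finsetSum _ fun i _ => int1 i, integral_finsetSum _ fun i _ => int2 i]
  exact Finset.sum_congr rfl fun i _ => key i

lemma integral_lap_eq_zero {v : R2 → ℝ} (hv : ContDiff ℝ 2 v) (hc : HasCompactSupport v) :
    ∫ x, lap v x = 0 := by
  have h := integral_mul_lap (L := fun _ => 1) contDiff_const hv hc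
  simpa [lap_apply (fun _ : R2 => (1 : ℝ))] using h

lemma hasDerivAt_max_zero_pow (n : ℕ) (t : ℝ) :
    HasDerivAt (fun s : ℝ => max s 0 ^ (n + 2)) ((n + 2) * max t 0 ^ (n + 1)) t := by
  rcases lt_trichotomy t 0 with ht | rfl | ht
  · have h : (fun s : ℝ => max s 0 ^ (n + 2)) =ᶠ[𝓝 t] fun _ => 0 := by
      filter_upwards [Iio_mem_nhds ht] with s hs
      simp [max_eq_right (le_of_lt (mem_Iio.1 hs))]
    rw [max_eq_right ht.le]
    simpa using (hasDerivAt_const t (0 : ℝ)).congr_of_eventuallyEq h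
  · rw [hasDerivAt_iff_isLittleO]
    have h : (fun s : ℝ => max s 0 ^ (n + 2)) =O[𝓝 0] fun s : ℝ => s ^ (n + 2) := by
      refine Asymptotics.IsBigO.of_bound 1 (Eventually.of_forall fun s => ?_)
      rw [norm_pow, norm_pow, one_mul]
      refine pow_le_pow_left₀ (norm_nonneg _) ?_ _
      rcases le_total s 0 with hs | hs <;> simp [hs]
    have h2 : (fun s : ℝ => s ^ (n + 2)) =o[𝓝 0] fun s : ℝ => s := by
      simpa using Asymptotics.isLittleO_pow_pow (𝕜 := ℝ) (m := 1) (n := n + 2) (by omega)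
    simpa using h.trans_isLittleO h2
  · have h : (fun s : ℝ => max s 0 ^ (n + 2)) =ᶠ[𝓝 t] fun s => s ^ (n + 2) := by
      filter_upwards [Ioi_mem_nhds ht] with s hs
      simp [max_eq_left (le_of_lt (mem_Ioi.1 hs))]
    rw [max_eq_left ht.le]
    simpa using (hasDerivAt_pow (n + 2) t).congr_of_eventuallyEq h

lemma hasDerivAt_max_sub_pow (n : ℕ) (a t : ℝ) :
    HasDerivAt (fun s : ℝ => max (s - a) 0 ^ (n + 2)) ((n + 2) * max (t - a) 0 ^ (n + 1)) t :=
  (hasDerivAt_max_zero_pow n (t - a)).comp_sub_const t a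

lemma contDiff_max_sub_pow_three (a : ℝ) : ContDiff ℝ 2 fun s : ℝ => max (s - a) 0 ^ 3 := by
  have h3 := hasDerivAt_max_sub_pow 1 a
  have h2 := hasDerivAt_max_sub_pow 0 a
  have e3 : deriv (fun s : ℝ => max (s - a) 0 ^ 3) = fun s => 3 * max (s - a) 0 ^ 2 := by
    ext t
    rw [(h3 t).deriv]
    norm_num
  have e2 : deriv (fun s : ℝ => max (s - a) 0 ^ 2) = fun s => 2 * max (s - a) 0 := by
    ext t
    rw [(h2 t).deriv]
    norm_num
  rw [show (2 : WithTop ℕ∞) = 1 + 1 by norm_num, contDiff_succ_iff_deriv]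
  refine ⟨fun t => (h3 t).differentiableAt, by simp, ?_⟩
  rw [e3]
  refine contDiff_const.mul ?_
  rw [contDiff_one_iff_deriv, e2]
  exact ⟨fun t => (h2 t).differentiableAt, by fun_prop⟩

lemma mul_rpow_le_exp_add {s a p : ℝ} (hs : 0 ≤ s) (ha : 0 ≤ a) (hp : 1 < p) :
    s * a ^ p ≤ exp s + (p + 1) * (a * a ^ p) := by
  have hp1 : 0 < p + 1 := by linarith
  have hap : 0 ≤ a ^ p := rpow_nonneg ha p
  rcases le_total s ((p + 1) * a) with h | h
  · nlinarith [mul_le_mul_of_nonneg_right h hap, exp_pos s]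
  · set t := s / (p + 1) with ht
    have hst : s = (p + 1) * t := by rw [ht]; field_simp
    have ht0 : 0 ≤ t := div_nonneg hs hp1.le
    have hat : a ≤ t := by rw [hst] at h; exact le_of_mul_le_mul_left h hp1
    have h1 : s * a ^ p ≤ (p + 1) * t ^ (p + 1) := by
      rw [rpow_add_one' ht0 hp1.ne', hst]
      have := rpow_le_rpow ha hat (by linarith : (0 : ℝ) ≤ p)
      nlinarith [mul_nonneg hp1.le ht0]
    have h2 : exp 1 * t ≤ exp t := by
      have := add_one_le_exp (t - 1)
      rw [exp_sub] at this
      rw [sub_add_cancel, le_div_iff₀ (exp_pos 1)] at this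
      linarith
    have h3 : exp (p + 1) * t ^ (p + 1) ≤ exp s := by
      have := rpow_le_rpow (by positivity) h2 hp1.le
      rw [mul_rpow (exp_pos 1).le ht0, ← exp_mul, ← exp_mul, one_mul] at this
      rwa [hst, mul_comm (p + 1) t]
    have h4 : p + 1 ≤ exp (p + 1) := by linarith [add_one_le_exp (p + 1)]
    have h5 : 0 ≤ t ^ (p + 1) := rpow_nonneg ht0 _
    nlinarith [mul_le_mul_of_nonneg_right h4 h5, mul_nonneg hp1.le (mul_nonneg ha hap)]

lemma integrableOn_ball_norm_inv (r : ℝ) :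
    IntegrableOn (fun y : R2 => ‖y‖⁻¹) (ball 0 r) := by
  rw [integrableOn_fun_norm_addHaar volume (f := fun t : ℝ => t⁻¹)]
  have h : IntegrableOn (fun _ : ℝ => (1 : ℝ)) (Ioo 0 r) := by simp
  refine h.congr_fun (fun t ht => ?_) measurableSet_Ioo
  simp [ht.1.ne']

lemma lap_comp {h h₁ : ℝ → ℝ} {h₂ : ℝ} {u : R2 → ℝ} {x : R2}
    (hh : ∀ᶠ t in 𝓝 (u x), HasDerivAt h (h₁ t) t) (hh₁ : HasDerivAt h₁ h₂ (u x))
    (hu : ContDiffAt ℝ 2 u x) :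
    lap (fun y => h (u y)) x = h₂ * ‖gradient u x‖ ^ 2 + h₁ (u x) * lap u x := by
  rw [← sum_fderiv_single_sq, lap_apply, lap_apply, Finset.mul_sum, Finset.mul_sum,
    ← Finset.sum_add_distrib]
  refine Finset.sum_congr rfl fun i _ => ?_
  set e : R2 := EuclideanSpace.single i 1
  have hd : ∀ᶠ y in 𝓝 x, DifferentiableAt ℝ u y :=
    (hu.eventually (by simp)).mono fun y hy => hy.differentiableAt (by norm_num)
  have h1 : (fun y => fderiv ℝ (fun z => h (u z)) y e) =ᶠ[𝓝 x]
      fun y => h₁ (u y) * fderiv ℝ u y e := by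
    filter_upwards [hd, hu.continuousAt.eventually hh] with y hy hy'
    have h' : HasFDerivAt (fun z => h (u z)) (h₁ (u y) • fderiv ℝ u y) y :=
      hy'.comp_hasFDerivAt y hy.hasFDerivAt
    rw [h'.fderiv]
    simp
  have h2 : HasFDerivAt (fun y => h₁ (u y)) (h₂ • fderiv ℝ u x) x :=
    hh₁.comp_hasFDerivAt x hd.self_of_nhds.hasFDerivAt
  have h3 : DifferentiableAt ℝ (fun y => fderiv ℝ u y e) x :=
    ((hu.fderiv_right (m := 1) (by norm_num)).differentiableAt (by norm_num)).clm_apply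
      (differentiableAt_const _)
  rw [h1.fderiv_eq, (h2.fun_mul h3.hasFDerivAt).fderiv]
  simp only [add_apply, smul_apply, smul_eq_mul]
  ring

lemma hasFDerivAt_norm_sub_sq (x₀ x : R2) (c : ℝ) :
    HasFDerivAt (fun y => ‖y - x₀‖ ^ 2 + c) (2 • innerSL ℝ (x - x₀)) x := by
  simpa using (((hasFDerivAt_id x).sub_const x₀).norm_sq).add_const c

lemma norm_gradient_norm_sub_sq (x₀ x : R2) (c : ℝ) :
    ‖gradient (fun y => ‖y - x₀‖ ^ 2 + c) x‖ ^ 2 = 4 * ‖x - x₀‖ ^ 2 := by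
  rw [norm_gradient_eq, (hasFDerivAt_norm_sub_sq x₀ x c).fderiv, ← Nat.cast_smul_eq_nsmul ℝ,
    norm_smul, innerSL_apply_norm]
  norm_num
  ring

lemma lap_norm_sub_sq (x₀ x : R2) (c : ℝ) : lap (fun y => ‖y - x₀‖ ^ 2 + c) x = 4 := by
  have h : ∀ i : Fin 2, (fun y => fderiv ℝ (fun y => ‖y - x₀‖ ^ 2 + c) y
      (EuclideanSpace.single i 1)) = fun y => 2 * innerSL ℝ (EuclideanSpace.single i 1) (y - x₀) := by
    intro i
    ext y
    rw [(hasFDerivAt_norm_sub_sq x₀ y c).fderiv]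
    simp [EuclideanSpace.inner_single_left, EuclideanSpace.inner_single_right]
  have h' : ∀ i : Fin 2, HasFDerivAt (fun y : R2 =>
      2 * innerSL ℝ (EuclideanSpace.single i (1 : ℝ)) (y - x₀))
      ((2 : ℝ) • innerSL ℝ (EuclideanSpace.single i 1)) x := fun i =>
    (((innerSL ℝ (EuclideanSpace.single i (1 : ℝ))).hasFDerivAt).comp x
      ((hasFDerivAt_id x).sub_const x₀)).const_mul 2
  rw [lap_apply]
  simp only [h, (h' _).fderiv]
  simp
  norm_num

/-- A smooth regularization of the logarithmic kernel centred at `x₀`. -/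
def regLog (x₀ : R2) (δ : ℝ) (y : R2) : ℝ := 1 / 2 * Real.log (‖y - x₀‖ ^ 2 + δ ^ 2)

lemma contDiff_regLog (x₀ : R2) {δ : ℝ} (hδ : 0 < δ) : ContDiff ℝ 2 (regLog x₀ δ) := by
  refine contDiff_const.mul (ContDiff.log ?_ fun y => by positivity)
  exact ((contDiff_id.sub contDiff_const).norm_sq ℝ).add contDiff_const

lemma lap_regLog (x₀ : R2) {δ : ℝ} (hδ : 0 < δ) (x : R2) :
    lap (regLog x₀ δ) x = 2 * δ ^ 2 / (‖x - x₀‖ ^ 2 + δ ^ 2) ^ 2 := by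
  have hq : 0 < ‖x - x₀‖ ^ 2 + δ ^ 2 := by positivity
  have h := lap_comp (h := fun t => 1 / 2 * Real.log t) (h₁ := fun t => 1 / 2 * t⁻¹)
    (h₂ := 1 / 2 * -((‖x - x₀‖ ^ 2 + δ ^ 2) ^ 2)⁻¹)
    (u := fun y => ‖y - x₀‖ ^ 2 + δ ^ 2) (x := x)
    ((eventually_ne_nhds hq.ne').mono fun t ht => (hasDerivAt_log ht).const_mul _)
    ((hasDerivAt_inv hq.ne').const_mul _)
    (((contDiff_id.sub contDiff_const).norm_sq ℝ).add contDiff_const).contDiffAt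
  rw [lap_norm_sub_sq, norm_gradient_norm_sub_sq] at h
  refine h.trans ?_
  field_simp
  ring

/-- The smooth truncation `((u - a)⁺)³`, extended by zero outside `Ω`. -/
def cubicTrunc (Ω : Set R2) (u : R2 → ℝ) (a : ℝ) : R2 → ℝ :=
  Ω.indicator fun x => max (u x - a) 0 ^ 3

section Truncation

variable {Ω : Set R2} {u : R2 → ℝ} {a : ℝ}

lemma cubicTrunc_eventuallyEq_of_mem (hop : IsOpen Ω) {x : R2} (hx : x ∈ Ω) :
    cubicTrunc Ω u a =ᶠ[𝓝 x] fun y => max (u y - a) 0 ^ 3 := by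
  filter_upwards [hop.mem_nhds hx] with y hy
  exact indicator_of_mem hy _

lemma cubicTrunc_eventuallyEq_zero (hop : IsOpen Ω) (hcont : ContinuousOn u (closure Ω))
    (hbd : ∀ x ∈ frontier Ω, u x = 0) (ha : 0 < a) {x : R2} (hx : x ∉ Ω) :
    cubicTrunc Ω u a =ᶠ[𝓝 x] fun _ => 0 := by
  by_cases hxc : x ∈ closure Ω
  · have hux : u x < a := by
      rw [hbd x ⟨hxc, by rwa [hop.interior_eq]⟩]
      exact ha
    have h := (hcont x hxc).eventually (Iio_mem_nhds hux)
    rw [eventually_nhdsWithin_iff] at h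
    filter_upwards [h] with y hy
    by_cases hyΩ : y ∈ Ω
    · have : u y < a := hy (subset_closure hyΩ)
      rw [cubicTrunc, indicator_of_mem hyΩ, max_eq_right (by linarith)]
      norm_num
    · exact indicator_of_notMem hyΩ _
  · filter_upwards [isClosed_closure.isOpen_compl.mem_nhds hxc] with y hy
    exact indicator_of_notMem (fun h => hy (subset_closure h)) _

lemma contDiff_cubicTrunc (hop : IsOpen Ω) (hu : ContDiffOn ℝ 2 u Ω)
    (hcont : ContinuousOn u (closure Ω)) (hbd : ∀ x ∈ frontier Ω, u x = 0) (ha : 0 < a) :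
    ContDiff ℝ 2 (cubicTrunc Ω u a) := by
  rw [contDiff_iff_contDiffAt]
  intro x
  by_cases hx : x ∈ Ω
  · refine ContDiffAt.congr_of_eventuallyEq ?_ (cubicTrunc_eventuallyEq_of_mem hop hx)
    exact (contDiff_max_sub_pow_three a).contDiffAt.comp x (hu.contDiffAt (hop.mem_nhds hx))
  · exact contDiffAt_const.congr_of_eventuallyEq
      (cubicTrunc_eventuallyEq_zero hop hcont hbd ha hx)

lemma hasCompactSupport_cubicTrunc (hΩ : Bornology.IsBounded Ω) :
    HasCompactSupport (cubicTrunc Ω u a) :=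
  HasCompactSupport.of_support_subset_isCompact hΩ.isCompact_closure
    (support_indicator_subset.trans subset_closure)

lemma lap_cubicTrunc_of_mem (hop : IsOpen Ω) (hu : ContDiffOn ℝ 2 u Ω) {x : R2} (hx : x ∈ Ω) :
    lap (cubicTrunc Ω u a) x = 6 * max (u x - a) 0 * ‖gradient u x‖ ^ 2 +
      3 * max (u x - a) 0 ^ 2 * lap u x := by
  rw [lap_congr (cubicTrunc_eventuallyEq_of_mem hop hx)]
  refine lap_comp (h := fun t => max (t - a) 0 ^ 3) (h₁ := fun t => 3 * max (t - a) 0 ^ 2)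
    (h₂ := 6 * max (u x - a) 0) (Eventually.of_forall fun t => ?_) ?_
    (hu.contDiffAt (hop.mem_nhds hx))
  · exact (hasDerivAt_max_sub_pow 1 a t).congr_deriv (by norm_num)
  · refine ((hasDerivAt_max_sub_pow 0 a (u x)).const_mul 3).congr_deriv ?_
    norm_num
    ring

lemma lap_cubicTrunc_of_notMem (hop : IsOpen Ω) (hcont : ContinuousOn u (closure Ω))
    (hbd : ∀ x ∈ frontier Ω, u x = 0) (ha : 0 < a) {x : R2} (hx : x ∉ Ω) :
    lap (cubicTrunc Ω u a) x = 0 := by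
  rw [lap_congr (cubicTrunc_eventuallyEq_zero hop hcont hbd ha hx)]
  simp [lap]

end Truncation

lemma exists_norm_fderiv_le {Ω : Set R2} {u : R2 → ℝ} (hop : IsOpen Ω)
    (hΩ : Bornology.IsBounded Ω) (hu : ContDiffOn ℝ 1 u (closure Ω)) :
    ∃ C : ℝ, ∀ x ∈ Ω, ‖fderiv ℝ u x‖ ≤ C := by
  have h : ∃ C : ℝ, ∀ x ∈ closure Ω, x ∈ Ω → ‖fderiv ℝ u x‖ ≤ C := by
    refine hΩ.isCompact_closure.induction_on
      (p := fun s => ∃ C : ℝ, ∀ x ∈ s, x ∈ Ω → ‖fderiv ℝ u x‖ ≤ C) ⟨0, by simp⟩ ?_ ?_ ?_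
    · rintro s t hst ⟨C, hC⟩
      exact ⟨C, fun x hx => hC x (hst hx)⟩
    · rintro s t ⟨C, hC⟩ ⟨D, hD⟩
      refine ⟨max C D, fun x hx hxΩ => ?_⟩
      rcases hx with hx | hx
      · exact (hC x hx hxΩ).trans (le_max_left _ _)
      · exact (hD x hx hxΩ).trans (le_max_right _ _)
    · intro x hx
      have h1 := hu x hx
      rw [show (1 : WithTop ℕ∞) = 0 + 1 by norm_num,
        contDiffWithinAt_succ_iff_hasFDerivWithinAt' (by simp), insert_eq_of_mem hx] at h1
      obtain ⟨V, hV, -, -, f', hf', hc⟩ := h1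
      have h2 := hc.continuousWithinAt.norm.eventually (Iio_mem_nhds (lt_add_one ‖f' x‖))
      refine ⟨{y | y ∈ V ∧ ‖f' y‖ < ‖f' x‖ + 1}, inter_mem hV h2, ‖f' x‖ + 1, ?_⟩
      rintro y ⟨hyV, hy⟩ hyΩ
      rw [((hf' y hyV).hasFDerivAt
        (mem_of_superset (hop.mem_nhds hyΩ) subset_closure)).fderiv]
      exact hy.le
  obtain ⟨C, hC⟩ := h
  exact ⟨C, fun x hx => hC x (subset_closure hx) hx⟩

lemma integrableOn_norm_gradient_sq {Ω : Set R2} {u : R2 → ℝ} (hop : IsOpen Ω)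
    (hΩ : Bornology.IsBounded Ω) (hu2 : ContDiffOn ℝ 2 u Ω) (hu : ContDiffOn ℝ 1 u (closure Ω)) :
    IntegrableOn (fun x => ‖gradient u x‖ ^ 2) Ω := by
  obtain ⟨C, hC⟩ := exists_norm_fderiv_le hop hΩ hu
  simp only [norm_gradient_eq]
  have hcont : ContinuousOn (fun x => ‖fderiv ℝ u x‖ ^ 2) Ω :=
    ((hu2.continuousOn_fderiv_of_isOpen hop (by norm_num)).norm).pow 2
  have : IsFiniteMeasure (volume.restrict Ω) := ⟨by simpa using hΩ.measure_lt_top⟩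
  refine Integrable.of_bound (hcont.aestronglyMeasurable hop.measurableSet) (C ^ 2) ?_
  filter_upwards [ae_restrict_mem hop.measurableSet] with x hx
  rw [norm_pow, norm_norm]
  exact pow_le_pow_left₀ (norm_nonneg _) (hC x hx) 2

lemma exists_le_integral_lap_regLog_mul {v : R2 → ℝ} (hv : Continuous v) (h0 : ∀ x, 0 ≤ v x)
    (hc : HasCompactSupport v) (x₀ : R2) :
    ∃ δ : ℝ, 0 < δ ∧ δ ≤ 1 ∧ v x₀ * π / 4 ≤ ∫ x, lap (regLog x₀ δ) x * v x := by
  rcases (h0 x₀).eq_or_lt with hx₀ | hx₀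
  · refine ⟨1, one_pos, le_rfl, ?_⟩
    rw [← hx₀, zero_mul, zero_div]
    refine integral_nonneg fun x => mul_nonneg ?_ (h0 x)
    rw [lap_regLog x₀ one_pos]
    positivity
  obtain ⟨η, hη, hball⟩ := Metric.eventually_nhds_iff_ball.1
    (hv.continuousAt.eventually (Ioi_mem_nhds (half_lt_self hx₀)))
  refine ⟨min η 1, lt_min hη one_pos, min_le_right _ _, ?_⟩
  set δ := min η 1
  have hδ : 0 < δ := lt_min hη one_pos
  have hnn : ∀ x, 0 ≤ lap (regLog x₀ δ) x * v x := fun x => by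
    rw [lap_regLog x₀ hδ]
    exact mul_nonneg (by positivity) (h0 x)
  have hint : Integrable fun x => lap (regLog x₀ δ) x * v x :=
    ((continuous_lap (contDiff_regLog x₀ hδ)).mul hv).integrable_of_hasCompactSupport hc.mul_left
  have hvol : volume.real (ball x₀ δ) = δ ^ 2 * π := by
    rw [measureReal_def, EuclideanSpace.volume_ball_fin_two, ENNReal.toReal_mul,
      ENNReal.toReal_pow, ENNReal.toReal_ofReal hδ.le, ENNReal.toReal_ofReal pi_pos.le]
  have hlow : ∫ _ in ball x₀ δ, v x₀ / (4 * δ ^ 2) ≤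
      ∫ x in ball x₀ δ, lap (regLog x₀ δ) x * v x := by
    refine setIntegral_mono_on (integrableOn_const measure_ball_lt_top.ne) hint.integrableOn
      measurableSet_ball fun x hx => ?_
    have hd : ‖x - x₀‖ < δ := by rwa [mem_ball, dist_eq_norm] at hx
    have hvx : v x₀ / 2 < v x := hball x (ball_subset_ball (min_le_left _ _) hx)
    have hk : 1 / (2 * δ ^ 2) ≤ lap (regLog x₀ δ) x := by
      rw [lap_regLog x₀ hδ, div_le_div_iff₀ (by positivity) (by positivity)]
      have h1 : ‖x - x₀‖ ^ 2 ≤ δ ^ 2 := pow_le_pow_left₀ (norm_nonneg _) hd.le 2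
      nlinarith [sq_nonneg ‖x - x₀‖]
    calc v x₀ / (4 * δ ^ 2) = 1 / (2 * δ ^ 2) * (v x₀ / 2) := by field_simp; norm_num
      _ ≤ _ := mul_le_mul hk hvx.le (by positivity) (le_trans (by positivity) hk)
  calc v x₀ * π / 4 = ∫ _ in ball x₀ δ, v x₀ / (4 * δ ^ 2) := by
        rw [setIntegral_const, hvol, smul_eq_mul]
        field_simp
    _ ≤ _ := hlow
    _ ≤ _ := setIntegral_le_integral hint (Eventually.of_forall hnn)

lemma setIntegral_inv_norm_sub_le {Ω : Set R2} {x₀ : R2} {R : ℝ} (hsub : Ω ⊆ ball x₀ R) :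
    IntegrableOn (fun x => ‖x - x₀‖⁻¹) Ω ∧
      ∫ x in Ω, ‖x - x₀‖⁻¹ ≤ ∫ y in ball (0 : R2) R, ‖y‖⁻¹ := by
  have hpre : (fun x : R2 => x - x₀) ⁻¹' ball 0 R = ball x₀ R := by
    ext x
    simp [dist_eq_norm]
  have hmp := measurePreserving_sub_right (volume : Measure R2) x₀
  have hme : MeasurableEmbedding fun x : R2 => x - x₀ := measurableEmbedding_subRight x₀
  have hint : IntegrableOn (fun x => ‖x - x₀‖⁻¹) (ball x₀ R) := by
    rw [← hpre]
    exact (hmp.integrableOn_comp_preimage hme).2 (integrableOn_ball_norm_inv R)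
  refine ⟨hint.mono_set hsub, ?_⟩
  have heq := hmp.setIntegral_preimage_emb hme (fun y => ‖y‖⁻¹) (ball 0 R)
  rw [hpre] at heq
  rw [← heq]
  exact setIntegral_mono_set hint (Eventually.of_forall fun x => by positivity)
    (LE.le.eventuallyLE hsub)

/-- At a positive maximum, a Lane–Emden solution is controlled by its Dirichlet energy. -/
lemma max_le_of_isSolution {Ω : Set R2} (hop : IsOpen Ω) (hΩ : Bornology.IsBounded Ω)
    {p : ℝ} (hp : 1 < p) {u : R2 → ℝ} (hsol : IsSolution Ω p u) {x₀ : R2} (hx₀ : x₀ ∈ Ω)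
    (hpos : 0 < u x₀) (hmax : ∀ x ∈ Ω, u x ≤ u x₀) {R : ℝ} (hR : 0 < R) (hsub : Ω ⊆ ball x₀ R) :
    u x₀ * π / 32 ≤ 3 / 4 * ((R + 1) * ∫ y in ball (0 : R2) R, ‖y‖⁻¹) +
      3 * ((p + 1) * ∫ x in Ω, ‖gradient u x‖ ^ 2) := by
  obtain ⟨hu2, hu1, heq, hbd⟩ := hsol
  set M := u x₀
  set v := cubicTrunc Ω u (M / 2)
  have hM2 : 0 < M / 2 := half_pos hpos
  have hv : ContDiff ℝ 2 v := contDiff_cubicTrunc hop hu2 hu1.continuousOn hbd hM2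
  have hc : HasCompactSupport v := hasCompactSupport_cubicTrunc hΩ
  have hv0 : ∀ x, 0 ≤ v x := fun x => indicator_nonneg (fun y _ => by positivity) x
  have hvx₀ : v x₀ = M ^ 3 / 8 := by
    rw [show v x₀ = max (u x₀ - M / 2) 0 ^ 3 from indicator_of_mem hx₀ _,
      max_eq_left (by linarith)]
    ring
  obtain ⟨δ, hδ, hδ1, hlow⟩ := exists_le_integral_lap_regLog_mul hv.continuous hv0 hc x₀
  have hL := contDiff_regLog x₀ hδ
  have hlapc : HasCompactSupport (lap v) := by
    refine HasCompactSupport.of_support_subset_isCompact hΩ.isCompact_closure fun x hx => ?_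
    by_contra hxΩ
    exact hx (lap_cubicTrunc_of_notMem hop hu1.continuousOn hbd hM2
      fun h => hxΩ (subset_closure h))
  have hlapI : Integrable (lap v) := (continuous_lap hv).integrable_of_hasCompactSupport hlapc
  have hLlapI : Integrable fun x => regLog x₀ δ x * lap v x :=
    (hL.continuous.mul (continuous_lap hv)).integrable_of_hasCompactSupport hlapc.mul_left
  have hout : ∀ x, x ∉ Ω → lap v x = 0 := fun x hx =>
    lap_cubicTrunc_of_notMem hop hu1.continuousOn hbd hM2 hx
  set K := Real.log (R + 1)
  have hrepr : ∫ x, lap (regLog x₀ δ) x * v x =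
      ∫ x in Ω, (K - regLog x₀ δ x) * -lap v x := by
    rw [← integral_mul_lap hL hv hc, setIntegral_eq_integral_of_forall_compl_eq_zero
      (fun x hx => by rw [hout x hx]; simp)]
    have h : ∀ x, (K - regLog x₀ δ x) * -lap v x = regLog x₀ δ x * lap v x - K * lap v x :=
      fun x => by ring
    simp only [h]
    rw [integral_sub hLlapI (hlapI.const_mul K), integral_const_mul, integral_lap_eq_zero hv hc]
    simp
  have hlapΩ : ∫ x in Ω, lap v x = 0 := by
    rw [setIntegral_eq_integral_of_forall_compl_eq_zero hout, integral_lap_eq_zero hv hc]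
  obtain ⟨hinvI, hinv⟩ := setIntegral_inv_norm_sub_le hsub
  have hgradI := integrableOn_norm_gradient_sq hop hΩ hu2 hu1
  have hpt : ∀ x ∈ Ω, x ≠ x₀ → (K - regLog x₀ δ x) * -lap v x ≤
      3 / 4 * M ^ 2 * (R + 1) * ‖x - x₀‖⁻¹ + (p + 1) * M * -lap v x +
        3 * (p + 1) * M ^ 2 * ‖gradient u x‖ ^ 2 := by
    intro x hx hne
    have hr : 0 < ‖x - x₀‖ := norm_pos_iff.2 (sub_ne_zero.2 hne)
    have hrR : ‖x - x₀‖ < R := by simpa [dist_eq_norm] using hsub hx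
    have hs : 0 ≤ K - regLog x₀ δ x := by
      have h1 : ‖x - x₀‖ ^ 2 + δ ^ 2 ≤ (R + 1) ^ 2 := by nlinarith
      have h2 := Real.log_le_log (by positivity) h1
      rw [Real.log_pow] at h2
      norm_num at h2
      simp only [regLog, K]
      linarith
    have hexp : exp (K - regLog x₀ δ x) ≤ (R + 1) * ‖x - x₀‖⁻¹ := by
      have h1 : Real.log ‖x - x₀‖ ≤ regLog x₀ δ x := by
        have h2 := Real.log_le_log (by positivity)
          (le_add_of_nonneg_right (sq_nonneg δ) : ‖x - x₀‖ ^ 2 ≤ ‖x - x₀‖ ^ 2 + δ ^ 2)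
        rw [Real.log_pow] at h2
        norm_num at h2
        simp only [regLog]
        linarith
      calc exp (K - regLog x₀ δ x) ≤ exp (K - Real.log ‖x - x₀‖) := by gcongr
        _ = (R + 1) * ‖x - x₀‖⁻¹ := by
          rw [exp_sub, exp_log (by positivity), exp_log hr, div_eq_mul_inv]
    have hlap := lap_cubicTrunc_of_mem (a := M / 2) hop hu2 hx
    have hux := heq x hx
    have hxM := hmax x hx
    change lap v x = _ at hlap
    have hG := sq_nonneg ‖gradient u x‖
    rcases le_total (u x) (M / 2) with hle | hge
    · rw [max_eq_right (by linarith)] at hlap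
      rw [hlap]
      simp only [ne_eq, OfNat.ofNat_ne_zero, not_false_eq_true, zero_pow, mul_zero, zero_mul,
        add_zero, neg_zero]
      positivity
    · rw [max_eq_left (by linarith)] at hlap
      have hu0 : 0 < u x := by linarith
      rw [abs_of_pos hu0, rpow_sub_one hu0.ne', div_mul_cancel₀ _ hu0.ne'] at hux
      have hy := mul_rpow_le_exp_add hs hu0.le hp
      have hup := rpow_nonneg hu0.le p
      set w := u x - M / 2
      set s := K - regLog x₀ δ x
      set G := ‖gradient u x‖ ^ 2
      set f := u x ^ p
      have hw0 : 0 ≤ w := by simp only [w]; linarith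
      have hwM : w ≤ M / 2 := by simp only [w]; linarith
      have hmin : -lap v x = 3 * w ^ 2 * f - 6 * w * G := by rw [hlap, ← hux]; ring
      have hw2 : w ^ 2 ≤ M ^ 2 / 4 := by nlinarith
      have e1 : s * -lap v x ≤ 3 * w ^ 2 * (s * f) := by
        rw [hmin]
        nlinarith [mul_nonneg hs (mul_nonneg hw0 hG)]
      have e2 : 3 * w ^ 2 * (s * f) ≤ 3 * w ^ 2 * (exp s + (p + 1) * (u x * f)) := by gcongr
      have e3 : 3 * w ^ 2 * exp s ≤ 3 / 4 * M ^ 2 * (R + 1) * ‖x - x₀‖⁻¹ := by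
        calc 3 * w ^ 2 * exp s ≤ 3 * (M ^ 2 / 4) * ((R + 1) * ‖x - x₀‖⁻¹) := by gcongr
          _ = _ := by ring
      have e4 : 3 * w ^ 2 * ((p + 1) * (u x * f)) ≤ (p + 1) * M * (3 * w ^ 2 * f) := by
        calc 3 * w ^ 2 * ((p + 1) * (u x * f)) ≤ 3 * w ^ 2 * ((p + 1) * (M * f)) := by gcongr
          _ = _ := by ring
      have e5 : (p + 1) * M * (6 * w * G) ≤ 3 * (p + 1) * M ^ 2 * G := by
        calc (p + 1) * M * (6 * w * G) ≤ (p + 1) * M * (6 * (M / 2) * G) := by gcongr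
          _ = _ := by ring
      have e6 : (p + 1) * M * (3 * w ^ 2 * f) = (p + 1) * M * -lap v x +
          (p + 1) * M * (6 * w * G) := by rw [hmin]; ring
      linarith
  have hI1 : IntegrableOn (fun x => 3 / 4 * M ^ 2 * (R + 1) * ‖x - x₀‖⁻¹) Ω :=
    hinvI.const_mul _
  have hI2 : IntegrableOn (fun x => (p + 1) * M * -lap v x) Ω :=
    (hlapI.neg.const_mul _).integrableOn
  have hI3 : IntegrableOn (fun x => 3 * (p + 1) * M ^ 2 * ‖gradient u x‖ ^ 2) Ω :=
    hgradI.const_mul _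
  have hI0 : IntegrableOn (fun x => (K - regLog x₀ δ x) * -lap v x) Ω := by
    refine Integrable.integrableOn (((hlapI.const_mul K).sub hLlapI).neg.congr ?_)
    exact Eventually.of_forall fun x => by simp; ring
  have hmono : ∫ x in Ω, (K - regLog x₀ δ x) * -lap v x ≤
      ∫ x in Ω, (3 / 4 * M ^ 2 * (R + 1) * ‖x - x₀‖⁻¹ + (p + 1) * M * -lap v x +
        3 * (p + 1) * M ^ 2 * ‖gradient u x‖ ^ 2) := by
    refine integral_mono_ae hI0 ((hI1.add hI2).add hI3) ?_
    have hne : ∀ᵐ x ∂(volume.restrict Ω), x ≠ x₀ :=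
      ae_restrict_of_ae (by simp [ae_iff])
    filter_upwards [ae_restrict_mem hop.measurableSet, hne] with x hx hxne
    exact hpt x hx hxne
  have hI12 : IntegrableOn (fun x => 3 / 4 * M ^ 2 * (R + 1) * ‖x - x₀‖⁻¹ +
      (p + 1) * M * -lap v x) Ω := hI1.add hI2
  rw [integral_add hI12 hI3, integral_add hI1 hI2, integral_const_mul,
    integral_const_mul, integral_const_mul, integral_neg, hlapΩ] at hmono
  rw [hrepr, hvx₀] at hlow
  set I := ∫ x in Ω, ‖gradient u x‖ ^ 2
  set B := ∫ y in ball (0 : R2) R, ‖y‖⁻¹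
  have hb : 3 / 4 * M ^ 2 * (R + 1) * ∫ x in Ω, ‖x - x₀‖⁻¹ ≤ 3 / 4 * M ^ 2 * (R + 1) * B := by
    gcongr
  have hfin : M ^ 2 * (M * π / 32) ≤ M ^ 2 * (3 / 4 * ((R + 1) * B) + 3 * ((p + 1) * I)) := by
    nlinarith
  exact le_of_mul_le_mul_left hfin (by positivity)

/-- A Lane–Emden solution is bounded above in terms of its Dirichlet energy. -/
lemma le_of_isSolution {Ω : Set R2} (hop : IsOpen Ω) (hΩ : Bornology.IsBounded Ω)
    {p : ℝ} (hp : 1 < p) {u : R2 → ℝ} (hsol : IsSolution Ω p u) {R : ℝ} (hR : 0 < R)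
    (hsub : ∀ x₀ ∈ Ω, Ω ⊆ ball x₀ R) {x : R2} (hx : x ∈ Ω) :
    u x * π / 32 ≤ 3 / 4 * ((R + 1) * ∫ y in ball (0 : R2) R, ‖y‖⁻¹) +
      3 * ((p + 1) * ∫ x in Ω, ‖gradient u x‖ ^ 2) := by
  obtain ⟨x₀, hx₀, hmax⟩ := hΩ.isCompact_closure.exists_isMaxOn ⟨x, subset_closure hx⟩
    hsol.2.1.continuousOn
  have hle : ∀ y ∈ Ω, u y ≤ u x₀ := fun y hy => hmax (subset_closure hy)
  rcases le_or_gt (u x₀) 0 with h0 | h0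
  · have hB : 0 ≤ ∫ y in ball (0 : R2) R, ‖y‖⁻¹ := integral_nonneg fun y => by positivity
    have hI : 0 ≤ ∫ x in Ω, ‖gradient u x‖ ^ 2 := integral_nonneg fun y => by positivity
    have h1 : u x * π / 32 ≤ 0 := by nlinarith [hle x hx, pi_pos]
    exact h1.trans (by positivity)
  · have hx₀Ω : x₀ ∈ Ω := by
      by_contra h
      exact h0.ne' (hsol.2.2.2 x₀ ⟨hx₀, by rwa [hop.interior_eq]⟩)
    refine le_trans ?_ (max_le_of_isSolution hop hΩ hp hsol hx₀Ω h0 hle hR (hsub x₀ hx₀Ω))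
    have := hle x hx
    gcongr

lemma IsSolution.neg {Ω : Set R2} {p : ℝ} {u : R2 → ℝ} (h : IsSolution Ω p u) :
    IsSolution Ω p fun y => -u y := by
  refine ⟨h.1.neg, h.2.1.neg, fun x hx => ?_, fun x hx => by simp [h.2.2.2 x hx]⟩
  rw [lap_neg, abs_neg, h.2.2.1 x hx, mul_neg]

theorem stmt5
    (Ω : Set R2) (hne : Ω.Nonempty) (hop : IsOpen Ω)
    (hbdd : Bornology.IsBounded Ω) (hconn : IsConnected Ω) (hsm : SmoothBoundary Ω)
    (u : ℝ → R2 → ℝ)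
    (hsol : ∀ p > (1:ℝ), IsSolution Ω p (u p))
    (hnod : ∀ p > (1:ℝ), IsNodal Ω (u p))
    (hA : CondA Ω u) :
    ∃ C > (0:ℝ), ∃ pbar > (1:ℝ), ∀ p ≥ pbar, ∀ x ∈ Ω, |u p x| ≤ C := by
  set R := Metric.diam Ω + 1
  have hR : 0 < R := by positivity
  have hsub : ∀ x₀ ∈ Ω, Ω ⊆ ball x₀ R := fun x₀ hx₀ x hx =>
    (Metric.dist_le_diam_of_mem hbdd hx hx₀).trans_lt (lt_add_one _)
  set B := ∫ y in ball (0 : R2) R, ‖y‖⁻¹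
  have hB : 0 ≤ B := integral_nonneg fun y => by positivity
  set A := 16 * π * exp 1 + 1
  have hA0 : 0 < A := by positivity
  set D := 3 / 4 * ((R + 1) * B) + 3 * (2 * A)
  have hD : 0 < D := by positivity
  obtain ⟨q, hq⟩ := eventually_atTop.1 (hA.eventually (Iio_mem_nhds (lt_add_one (16 * π * exp 1))))
  refine ⟨D * 32 / π, by positivity, max q 2, lt_max_of_lt_right one_lt_two, fun p hp x hx => ?_⟩
  have hp2 : 2 ≤ p := (le_max_right _ _).trans hp
  have hp1 : 1 < p := by linarith
  have henergy : (p + 1) * ∫ x in Ω, ‖gradient (u p) x‖ ^ 2 ≤ 2 * A := by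
    have h1 : p * ∫ x in Ω, ‖gradient (u p) x‖ ^ 2 < A := hq p ((le_max_left _ _).trans hp)
    have h2 : 0 ≤ ∫ x in Ω, ‖gradient (u p) x‖ ^ 2 := integral_nonneg fun y => by positivity
    nlinarith
  have hbound : ∀ w : R2 → ℝ, IsSolution Ω p w →
      ∫ x in Ω, ‖gradient w x‖ ^ 2 = ∫ x in Ω, ‖gradient (u p) x‖ ^ 2 → w x * π / 32 ≤ D := by
    intro w hw hwe
    refine (le_of_isSolution hop hbdd hp1 hw hR hsub hx).trans ?_
    rw [hwe]
    change 3 / 4 * ((R + 1) * B) + _ ≤ 3 / 4 * ((R + 1) * B) + _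
    gcongr
  have hup := hbound (u p) (hsol p hp1) rfl
  have hun := hbound (fun y => -u p y) (hsol p hp1).neg
    (by simp only [norm_gradient_eq, fderiv_fun_neg, norm_neg])
  rw [abs_le', le_div_iff₀ pi_pos, le_div_iff₀ pi_pos]
  constructor <;> linarith
end
end

section
/- Let (u_p)_{p>1} be a family of nodal solutions of (𝒫_p) satisfying condition (A). Then dist(x_p⁺, ∂Ω)/ε_p → +∞ as p → +∞. -/
open MeasureTheory Real Set Filter Topology Metric

noncomputable section

/-- The logarithmic potential of the parametrised arc `y` on `[0, r]`. -/
def arcPotential (y : ℝ → R2) (r : ℝ) (z : R2) : ℝ :=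
  ∫ t in (0 : ℝ)..r, Real.log ‖z - y t‖

lemma log_norm_cross_le {δ s : ℝ} (hsδ : |s| < δ) {w : R2} (hw : δ ≤ ‖w‖) :
    ∑ i : Fin 2, (Real.log ‖w + s • EuclideanSpace.single i (1 : ℝ)‖
      + Real.log ‖w - s • EuclideanSpace.single i (1 : ℝ)‖)
      ≤ 4 * Real.log ‖w‖ + (s / δ) ^ 4 := by
  have hδ : 0 < δ := (abs_nonneg s).trans_lt hsδ
  have hlog : ∀ v : R2, Real.log ‖v‖ = 1 / 2 * Real.log (v 0 ^ 2 + v 1 ^ 2) := by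
    intro v
    have : ‖v‖ ^ 2 = v 0 ^ 2 + v 1 ^ 2 := by
      rw [EuclideanSpace.norm_sq_eq]; simp
    rw [← this, Real.log_pow]; push_cast; ring
  have hpos : ∀ v : R2, 0 < ‖v‖ → 0 < v 0 ^ 2 + v 1 ^ 2 := by
    intro v hv
    have : ‖v‖ ^ 2 = v 0 ^ 2 + v 1 ^ 2 := by
      rw [EuclideanSpace.norm_sq_eq]; simp
    rw [← this]; positivity
  have hnorm : ∀ i : Fin 2, ‖s • EuclideanSpace.single i (1 : ℝ)‖ = |s| := by
    intro i; rw [norm_smul]; simp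
  have hp : ∀ i : Fin 2, 0 < ‖w + s • EuclideanSpace.single i (1 : ℝ)‖ := by
    intro i
    have := norm_sub_le_norm_add w (s • EuclideanSpace.single i (1 : ℝ))
    rw [hnorm] at this; linarith
  have hm : ∀ i : Fin 2, 0 < ‖w - s • EuclideanSpace.single i (1 : ℝ)‖ := by
    intro i
    have := norm_sub_norm_le w (s • EuclideanSpace.single i (1 : ℝ))
    rw [hnorm] at this; linarith
  have hp0 := hpos _ (hp 0)
  have hp1 := hpos _ (hp 1)
  have hm0 := hpos _ (hm 0)
  have hm1 := hpos _ (hm 1)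
  have hw0 : 0 < w 0 ^ 2 + w 1 ^ 2 := hpos _ (hδ.trans_le hw)
  have hwδ : δ ^ 2 ≤ w 0 ^ 2 + w 1 ^ 2 := by
    have : ‖w‖ ^ 2 = w 0 ^ 2 + w 1 ^ 2 := by
      rw [EuclideanSpace.norm_sq_eq]; simp
    rw [← this]; gcongr
  simp only [Fin.sum_univ_two, hlog]
  simp at hp0 hp1 hm0 hm1 ⊢
  generalize w 0 = a at *
  generalize w 1 = b at *
  have h1 : Real.log ((a + s) ^ 2 + b ^ 2) + Real.log ((a - s) ^ 2 + b ^ 2)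
      + Real.log (a ^ 2 + (b + s) ^ 2) + Real.log (a ^ 2 + (b - s) ^ 2)
      ≤ 2 * Real.log ((a ^ 2 + b ^ 2) ^ 2 + s ^ 4) := by
    rw [← Real.log_mul hp0.ne' hm0.ne', ← Real.log_mul (by positivity) hp1.ne',
      ← Real.log_mul (by positivity) hm1.ne']
    have : 2 * Real.log ((a ^ 2 + b ^ 2) ^ 2 + s ^ 4)
        = Real.log (((a ^ 2 + b ^ 2) ^ 2 + s ^ 4) ^ 2) := by
      rw [Real.log_pow]; push_cast; ring
    rw [this]
    apply Real.log_le_log (by positivity)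
    have : 0 ≤ 4 * s ^ 4 * (a ^ 2 - b ^ 2) ^ 2 := by positivity
    linarith
  have h2 : Real.log ((a ^ 2 + b ^ 2) ^ 2 + s ^ 4)
      ≤ 2 * Real.log (a ^ 2 + b ^ 2) + (s / δ) ^ 4 := by
    have h3 : (a ^ 2 + b ^ 2) ^ 2 + s ^ 4
        = (a ^ 2 + b ^ 2) ^ 2 * (1 + s ^ 4 / (a ^ 2 + b ^ 2) ^ 2) := by
      field_simp
    rw [h3, Real.log_mul (by positivity) (by positivity), Real.log_pow]
    have h4 := Real.log_le_sub_one_of_pos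
      (show 0 < 1 + s ^ 4 / (a ^ 2 + b ^ 2) ^ 2 by positivity)
    have h5 : s ^ 4 / (a ^ 2 + b ^ 2) ^ 2 ≤ (s / δ) ^ 4 := by
      rw [div_pow]
      have : δ ^ 4 ≤ (a ^ 2 + b ^ 2) ^ 2 := by
        calc δ ^ 4 = (δ ^ 2) ^ 2 := by ring
          _ ≤ _ := by gcongr
      gcongr
    push_cast
    linarith
  linarith

lemma le_mul_log {x r : ℝ} (hx : 0 ≤ x) (hr : 0 < r) :
    x * Real.log r + x - r ≤ x * Real.log x := by
  rcases hx.eq_or_lt with rfl | hx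
  · simp [hr.le]
  have h := Real.log_le_sub_one_of_pos (show 0 < r / x by positivity)
  rw [Real.log_div hr.ne' hx.ne'] at h
  have h2 : x * (Real.log r - Real.log x) ≤ x * (r / x - 1) := by gcongr
  have h3 : x * (r / x - 1) = r - x := by field_simp
  linarith

lemma le_integral_log_sub {r : ℝ} (hr : 0 < r) (c : ℝ) :
    r * (Real.log r - 2) ≤ ∫ t in (0 : ℝ)..r, Real.log (c - t) := by
  rw [intervalIntegral.integral_comp_sub_left (fun x => Real.log x), integral_log, sub_zero]
  rcases le_total c 0 with hc | hc
  · have h1 : (c - r) * Real.log (c - r) = -((r - c) * Real.log (r - c)) := by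
      rw [← Real.log_neg_eq_log (c - r), neg_sub]; ring
    have h2 : c * Real.log c = -((-c) * Real.log (-c)) := by
      rw [Real.log_neg_eq_log]; ring
    have h3 : r * Real.log r ≤ r * Real.log (r - c) := by gcongr; linarith
    have h4 : (-c) * Real.log (-c) ≤ (-c) * Real.log (r - c) := by
      rcases hc.eq_or_lt with rfl | hc
      · simp
      · refine mul_le_mul_of_nonneg_left ?_ (by linarith)
        exact Real.log_le_log (by linarith) (by linarith)
    rw [h1, h2]
    linarith
  rcases le_total r c with hrc | hrc
  · have h3 : r * Real.log r ≤ r * Real.log c := by gcongr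
    have h4 : (c - r) * Real.log (c - r) ≤ (c - r) * Real.log c := by
      rcases hrc.eq_or_lt with rfl | hc
      · simp
      · refine mul_le_mul_of_nonneg_left ?_ (by linarith)
        exact Real.log_le_log (by linarith) (by linarith)
    linarith
  · have h1 : (c - r) * Real.log (c - r) = -((r - c) * Real.log (r - c)) := by
      rw [← Real.log_neg_eq_log (c - r), neg_sub]; ring
    have h2 := le_mul_log hc hr
    have h3 := le_mul_log (sub_nonneg.2 hrc) hr
    rw [h1]
    linarith

lemma le_arcPotential {y : ℝ → R2} {r c : ℝ} {z : R2} (hr : 0 < r)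
    (hInt : IntervalIntegrable (fun t => Real.log ‖z - y t‖) volume 0 r)
    (hc : ∀ t, |c - t| ≤ ‖z - y t‖) :
    r * (Real.log r - 2) ≤ arcPotential y r z := by
  refine (le_integral_log_sub hr c).trans ?_
  refine intervalIntegral.integral_mono_ae hr.le ?_ hInt ?_
  · have := (intervalIntegral.intervalIntegrable_log' (a := c - 0) (b := c - r)).comp_sub_left c
    simpa using this
  · have : ∀ᵐ t ∂(volume : Measure ℝ), t ≠ c := by
      simp [ae_iff]
    filter_upwards [this] with t ht
    rw [← Real.log_abs]
    exact Real.log_le_log (abs_pos.2 (sub_ne_zero.2 ht.symm)) (hc t)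

lemma exists_pos_le_norm_sub {y : ℝ → R2} (hy : Continuous y) {r : ℝ} (hr : 0 ≤ r) {z : R2}
    (hz : ∀ t ∈ Icc 0 r, z ≠ y t) : ∃ δ > 0, ∀ t ∈ Icc 0 r, δ ≤ ‖z - y t‖ := by
  obtain ⟨t₀, ht₀, hmin⟩ := isCompact_Icc.exists_isMinOn (nonempty_Icc.2 hr)
    (f := fun t => ‖z - y t‖) (by fun_prop)
  exact ⟨‖z - y t₀‖, norm_pos_iff.2 (sub_ne_zero.2 (hz t₀ ht₀)), fun t ht => hmin ht⟩

lemma intervalIntegrable_log_norm_sub {y : ℝ → R2} (hy : Continuous y) {r δ : ℝ} (hr : 0 ≤ r)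
    (hδ : 0 < δ) {z : R2} (hz : ∀ t ∈ Icc 0 r, δ ≤ ‖z - y t‖) :
    IntervalIntegrable (fun t => Real.log ‖z - y t‖) volume 0 r := by
  apply ContinuousOn.intervalIntegrable
  rw [uIcc_of_le hr]
  exact ContinuousOn.log (by fun_prop) fun t ht => (hδ.trans_le (hz t ht)).ne'

lemma continuousAt_arcPotential {y : ℝ → R2} (hy : Continuous y) {r δ : ℝ} (hr : 0 ≤ r)
    (hδ : 0 < δ) {z : R2} (hz : ∀ t ∈ Icc 0 r, δ ≤ ‖z - y t‖) :
    ContinuousAt (arcPotential y r) z := by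
  have hcont : Continuous fun x => ∫ t in (0 : ℝ)..r, Real.log (max ‖x - y t‖ (δ / 2)) := by
    refine intervalIntegral.continuous_parametric_intervalIntegral_of_continuous'
      (f := fun x t => Real.log (max ‖x - y t‖ (δ / 2))) ?_ 0 r
    refine Continuous.log ?_ fun q => (lt_max_of_lt_right (half_pos hδ)).ne'
    fun_prop
  refine hcont.continuousAt.congr ?_
  filter_upwards [Metric.ball_mem_nhds z (half_pos hδ)] with x hx
  refine intervalIntegral.integral_congr fun t ht => ?_
  rw [uIcc_of_le hr] at ht
  have h1 : ‖z - y t‖ ≤ ‖x - z‖ + ‖x - y t‖ := by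
    have := norm_sub_le (x - y t) (x - z)
    rw [sub_sub_sub_cancel_left] at this
    linarith
  have h2 := hz t ht
  rw [mem_ball_iff_norm] at hx
  rw [max_eq_left (by linarith)]

lemma arcPotential_cross_le {y : ℝ → R2} (hy : Continuous y) {r δ s : ℝ} (hr : 0 ≤ r)
    (hsδ : |s| < δ) {z : R2} (hz : ∀ t ∈ Icc 0 r, δ ≤ ‖z - y t‖) :
    ∑ i : Fin 2, (arcPotential y r (z + s • EuclideanSpace.single i (1 : ℝ))
      + arcPotential y r (z - s • EuclideanSpace.single i (1 : ℝ)))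
      ≤ 4 * arcPotential y r z + r * (s / δ) ^ 4 := by
  have hδ : 0 < δ := (abs_nonneg s).trans_lt hsδ
  have hInt : ∀ v : R2, ‖v‖ = |s| →
      IntervalIntegrable (fun t => Real.log ‖z + v - y t‖) volume 0 r := by
    intro v hv
    refine intervalIntegrable_log_norm_sub hy hr (sub_pos.2 hsδ) fun t ht => ?_
    have h1 := norm_sub_le_norm_add (z - y t) v
    rw [sub_add_eq_add_sub, hv] at h1
    linarith [hz t ht]
  have hnorm : ∀ i : Fin 2, ‖s • EuclideanSpace.single i (1 : ℝ)‖ = |s| := by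
    intro i; rw [norm_smul]; simp
  have hp := fun i => hInt _ (hnorm i)
  have hm := fun i => hInt (-(s • EuclideanSpace.single i (1 : ℝ))) (by rw [norm_neg, hnorm])
  simp only [← sub_eq_add_neg] at hm
  have h0 := intervalIntegrable_log_norm_sub hy hr hδ hz
  have hconst : r * (s / δ) ^ 4 = ∫ _ in (0 : ℝ)..r, (s / δ) ^ 4 := by simp
  simp only [arcPotential]
  rw [hconst, ← intervalIntegral.integral_const_mul,
    ← intervalIntegral.integral_add (h0.const_mul 4) intervalIntegrable_const]
  have hsum : ∀ i ∈ (Finset.univ : Finset (Fin 2)), IntervalIntegrable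
      (fun t => Real.log ‖z + s • EuclideanSpace.single i (1 : ℝ) - y t‖
        + Real.log ‖z - s • EuclideanSpace.single i (1 : ℝ) - y t‖) volume 0 r :=
    fun i _ => (hp i).add (hm i)
  simp_rw [← intervalIntegral.integral_add (hp _) (hm _)]
  rw [← intervalIntegral.integral_finsetSum hsum]
  refine intervalIntegral.integral_mono_on hr ?_ ((h0.const_mul 4).add intervalIntegrable_const)
    fun t ht => ?_
  · simp only [Fin.sum_univ_two]
    exact ((hp 0).add (hm 0)).add ((hp 1).add (hm 1))
  · have := log_norm_cross_le hsδ (hz t ht)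
    simp only [sub_add_eq_add_sub, sub_right_comm z (y t)] at this
    exact this

lemma hasDerivAt_add_smul {u : R2 → ℝ} {z e : R2} {s : ℝ}
    (h : DifferentiableAt ℝ u (z + s • e)) :
    HasDerivAt (fun s : ℝ => u (z + s • e)) (fderiv ℝ u (z + s • e) e) s := by
  have h1 : HasDerivAt (fun s : ℝ => z + s • e) e s := by
    simpa using ((hasDerivAt_id s).smul_const e).const_add z
  exact h.hasFDerivAt.comp_hasDerivAt s h1

lemma lap_add_le_zero {Ω : Set R2} (hop : IsOpen Ω) {u : R2 → ℝ} (hu : ContDiffOn ℝ 2 u Ω)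
    {z : R2} (hz : z ∈ Ω) {B C : ℝ}
    (h : ∀ᶠ s : ℝ in 𝓝 0, ∑ i : Fin 2, (u (z + s • EuclideanSpace.single i (1 : ℝ))
      + u (z - s • EuclideanSpace.single i (1 : ℝ))) + B * s ^ 2 ≤ 4 * u z + C * s ^ 4) :
    lap u z + B ≤ 0 := by
  by_contra! hpos
  set e : Fin 2 → R2 := fun i => EuclideanSpace.single i (1 : ℝ) with he
  set j : ℝ → ℝ := fun s => ∑ i : Fin 2, (u (z + s • e i) + u (z + s • (-e i)))
    + B * s ^ 2 - C * s ^ 4 with hj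
  set j' : ℝ → ℝ := fun s => ∑ i : Fin 2, (fderiv ℝ u (z + s • e i) (e i)
    - fderiv ℝ u (z + s • (-e i)) (e i)) + B * (2 * s) - C * (4 * s ^ 3) with hj'
  have hnear : ∀ v : R2, ∀ᶠ s : ℝ in 𝓝 0, z + s • v ∈ Ω := by
    intro v
    have : ContinuousAt (fun s : ℝ => z + s • v) 0 := by fun_prop
    exact this.eventually_mem (by simpa using hop.mem_nhds hz)
  have hdiff : ∀ x ∈ Ω, DifferentiableAt ℝ u x := fun x hx =>
    (hu.contDiffAt (hop.mem_nhds hx)).differentiableAt (by norm_num)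
  have hd1 : ∀ᶠ s in 𝓝 (0 : ℝ), HasDerivAt j (j' s) s := by
    filter_upwards [hnear (e 0), hnear (e 1), hnear (-e 0), hnear (-e 1)] with s h1 h2 h3 h4
    have hp : ∀ i : Fin 2, HasDerivAt (fun s : ℝ => u (z + s • e i) + u (z + s • (-e i)))
        (fderiv ℝ u (z + s • e i) (e i) - fderiv ℝ u (z + s • (-e i)) (e i)) s := by
      intro i
      rw [sub_eq_add_neg, ← map_neg]
      fin_cases i
      · exact (hasDerivAt_add_smul (hdiff _ h1)).add (hasDerivAt_add_smul (hdiff _ h3))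
      · exact (hasDerivAt_add_smul (hdiff _ h2)).add (hasDerivAt_add_smul (hdiff _ h4))
    have := ((HasDerivAt.fun_sum (u := Finset.univ) fun i _ => hp i).add
      ((hasDerivAt_pow 2 s).const_mul B)).sub ((hasDerivAt_pow 4 s).const_mul C)
    refine this.congr_deriv ?_
    simp [hj']
  have hd2 : HasDerivAt j' (2 * (lap u z + B)) 0 := by
    have hdd : ∀ i : Fin 2, DifferentiableAt ℝ (fun x => fderiv ℝ u x (e i)) z := by
      intro i
      have := (hu.contDiffAt (hop.mem_nhds hz)).fderiv_right (m := 1) (by norm_num)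
      exact (this.differentiableAt (by norm_num)).clm_apply (differentiableAt_const _)
    have hp : ∀ i : Fin 2, HasDerivAt (fun s : ℝ => fderiv ℝ u (z + s • e i) (e i)
        - fderiv ℝ u (z + s • (-e i)) (e i))
        (2 * fderiv ℝ (fun x => fderiv ℝ u x (e i)) z (e i)) 0 := by
      intro i
      have h1 := hasDerivAt_add_smul (u := fun x => fderiv ℝ u x (e i)) (z := z) (e := e i)
        (s := 0) (by simpa using hdd i)
      have h2 := hasDerivAt_add_smul (u := fun x => fderiv ℝ u x (e i)) (z := z) (e := -e i)
        (s := 0) (by simpa using hdd i)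
      refine (h1.sub h2).congr_deriv ?_
      simp
      ring
    have := ((HasDerivAt.fun_sum (u := Finset.univ) fun i _ => hp i).add
      (((hasDerivAt_id (0 : ℝ)).const_mul 2).const_mul B)).sub
      (((hasDerivAt_pow 3 (0 : ℝ)).const_mul 4).const_mul C)
    refine this.congr_deriv ?_
    simp [lap, he]
    ring
  have hj0 : j 0 = 4 * u z := by simp [hj]; ring
  have hj'0 : j' 0 = 0 := by simp [hj']
  have hderiv : deriv j =ᶠ[𝓝 0] j' := hd1.mono fun s hs => hs.deriv
  have hmin : IsLocalMin j 0 := by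
    refine isLocalMin_of_deriv_deriv_pos ?_ ?_ hd1.self_of_nhds.continuousAt
    · rw [hderiv.deriv_eq, hd2.deriv]; linarith
    · rw [hderiv.self_of_nhds, hj'0]
  have hconst : j =ᶠ[𝓝 0] fun _ => j 0 := by
    filter_upwards [hmin, h] with s h1 h2
    refine le_antisymm ?_ h1
    rw [hj0]
    simp only [hj, smul_neg, ← sub_eq_add_neg]
    linarith
  have h1 : deriv (deriv j) 0 = 0 := by
    have h2 : deriv j =ᶠ[𝓝 0] fun _ => 0 := by
      simpa using hconst.deriv
    rw [h2.deriv_eq, deriv_const]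
  rw [hderiv.deriv_eq, hd2.deriv] at h1
  linarith

lemma norm_add_smul_sq_add (w : R2) (s : ℝ) (i : Fin 2) :
    ‖w + s • EuclideanSpace.single i (1 : ℝ)‖ ^ 2 + ‖w - s • EuclideanSpace.single i (1 : ℝ)‖ ^ 2
      = 2 * ‖w‖ ^ 2 + 2 * s ^ 2 := by
  have h := parallelogram_law_with_norm ℝ w (s • EuclideanSpace.single i (1 : ℝ))
  have h2 : ‖s • EuclideanSpace.single i (1 : ℝ)‖ ^ 2 = s ^ 2 := by
    rw [norm_smul]; simp
  linarith

/-- A function `u ≤ M` vanishing on the boundary with `-Δu ≤ A` stays quantitatively below `M`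
at distance comparable to `r` from a boundary arc of size `r`. -/
lemma le_sub_of_boundary_arc {Ω : Set R2} (hop : IsOpen Ω)
    {u : R2 → ℝ} (hcont : ContinuousOn u (closure Ω)) (hu : ContDiffOn ℝ 2 u Ω)
    (hbd : ∀ x ∈ frontier Ω, u x = 0) {A M : ℝ} (hA : 0 < A) (hM : 0 < M)
    (hlap : ∀ x ∈ Ω, -lap u x ≤ A) (huM : ∀ x ∈ Ω, u x ≤ M)
    {y : ℝ → R2} {c : R2 → ℝ} {r L : ℝ} {x' : R2} (hr : 0 < r) (hL : 0 ≤ L)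
    (hy : Continuous y) (hyf : ∀ t ∈ Icc 0 r, y t ∈ frontier Ω)
    (hyL : ∀ t ∈ Icc 0 r, ‖y t - x'‖ ≤ L * r) (hc : ∀ z t, |c z - t| ≤ ‖z - y t‖)
    {x : R2} (hx : x ∈ Ω) (hxx' : ‖x - x'‖ ≤ L * r) :
    u x ≤ M - M / (3 + Real.log (2 * L + 1))
      + A / 2 * ((Real.exp 1 * (2 * L + 1) + L) * r) ^ 2 := by
  have hfr : ∀ z ∈ Ω, z ∉ frontier Ω := fun z hz hz' =>
    (hop.inter_frontier_eq ▸ (⟨hz, hz'⟩ : z ∈ Ω ∩ frontier Ω) : z ∈ (∅ : Set R2))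
  have hδ : ∀ z ∈ Ω, ∃ δ > 0, ∀ t ∈ Icc 0 r, δ ≤ ‖z - y t‖ := fun z hz =>
    exists_pos_le_norm_sub hy hr.le fun t ht h => hfr z hz (h ▸ hyf t ht)
  have hInt : ∀ z ∈ Ω, IntervalIntegrable (fun t => Real.log ‖z - y t‖) volume 0 r := by
    intro z hz
    obtain ⟨δ, hδ0, h⟩ := hδ z hz
    exact intervalIntegrable_log_norm_sub hy hr.le hδ0 h
  set K : ℝ := Real.exp 1 * (2 * L + 1) with hK
  have hKpos : 0 < K := by positivity
  have hlogK : Real.log K = 1 + Real.log (2 * L + 1) := by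
    rw [hK, Real.log_mul (by positivity) (by positivity), Real.log_exp]
  have hlogL : 0 ≤ Real.log (2 * L + 1) := Real.log_nonneg (by linarith)
  set S : ℝ := 3 + Real.log (2 * L + 1) with hS
  have hSpos : 0 < S := by positivity
  set R : ℝ := (K + L) * r with hR
  set ψ : R2 → ℝ := fun z => Real.log (K * r) - arcPotential y r z / r with hψ
  have hψS : ∀ z ∈ Ω, ψ z ≤ S := by
    intro z hz
    have h1 := le_arcPotential hr (hInt z hz) (hc z)
    have h2 : Real.log r - 2 ≤ arcPotential y r z / r := by
      rw [le_div_iff₀ hr]; linarith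
    simp only [hψ]
    rw [Real.log_mul hKpos.ne' hr.ne', hlogK]
    linarith
  have hψout : ∀ z ∈ Ω, R ≤ ‖z - x'‖ → ψ z ≤ 0 := by
    intro z hz hzR
    have h1 : ∫ _ in (0 : ℝ)..r, Real.log (K * r) ≤ arcPotential y r z := by
      refine intervalIntegral.integral_mono_on hr.le intervalIntegrable_const (hInt z hz) ?_
      intro t ht
      refine Real.log_le_log (by positivity) ?_
      have h2 := norm_sub_le_norm_sub_add_norm_sub z (y t) x'
      have h3 := hyL t ht
      rw [hR] at hzR
      linarith
    have h2 : Real.log (K * r) ≤ arcPotential y r z / r := by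
      rw [le_div_iff₀ hr]; simpa [mul_comm] using h1
    simp only [hψ]
    linarith
  have hψx : 1 ≤ ψ x := by
    have h1 : arcPotential y r x ≤ ∫ _ in (0 : ℝ)..r, Real.log ((2 * L + 1) * r) := by
      refine intervalIntegral.integral_mono_on hr.le (hInt x hx) intervalIntegrable_const ?_
      intro t ht
      obtain ⟨δ, hδ0, h⟩ := hδ x hx
      refine Real.log_le_log (hδ0.trans_le (h t ht)) ?_
      have h2 := norm_sub_le_norm_sub_add_norm_sub x x' (y t)
      have h3 := hyL t ht
      rw [norm_sub_rev] at h3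
      linarith
    have h2 : arcPotential y r x / r ≤ Real.log ((2 * L + 1) * r) := by
      rw [div_le_iff₀ hr]; simpa [mul_comm] using h1
    rw [Real.log_mul (by positivity) hr.ne'] at h2
    simp only [hψ]
    rw [Real.log_mul hKpos.ne' hr.ne', hlogK]
    linarith
  have hψcont : ∀ z ∈ Ω, ContinuousAt ψ z := by
    intro z hz
    obtain ⟨δ, hδ0, h⟩ := hδ z hz
    exact continuousAt_const.sub ((continuousAt_arcPotential hy hr.le hδ0 h).div_const r)
  set v : R2 → ℝ := fun z => u z - M + M / S * ψ z + A / 2 * (‖z - x'‖ ^ 2 - R ^ 2) with hv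
  have hβ : 0 < M / S := by positivity
  have hβS : M / S * S = M := div_mul_cancel₀ M hSpos.ne'
  have hvu : ∀ z ∈ Ω, ‖z - x'‖ ≤ R → v z ≤ u z := by
    intro z hz hzR
    have h1 : M / S * ψ z ≤ M / S * S := by gcongr; exact hψS z hz
    have h2 : ‖z - x'‖ ^ 2 ≤ R ^ 2 := by gcongr
    have h3 : A / 2 * (‖z - x'‖ ^ 2 - R ^ 2) ≤ 0 :=
      mul_nonpos_of_nonneg_of_nonpos (by positivity) (by linarith)
    simp only [hv]
    linarith
  have hvR : ∀ z ∈ Ω, ‖z - x'‖ = R → v z ≤ 0 := by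
    intro z hz hzR
    have h1 : M / S * ψ z ≤ 0 :=
      mul_nonpos_of_nonneg_of_nonpos hβ.le (hψout z hz hzR.ge)
    have h2 := huM z hz
    simp only [hv, hzR]
    linarith
  suffices hvx : v x ≤ 0 by
    have h1 : M / S * 1 ≤ M / S * ψ x := by gcongr
    have h2 : 0 ≤ A / 2 * ‖x - x'‖ ^ 2 := by positivity
    simp only [hv] at hvx
    linarith
  by_contra! hvx
  have hxR : ‖x - x'‖ ≤ R := by
    rw [hR]
    have : 0 < K * r := by positivity
    linarith
  set W : Set R2 := (closure Ω ∩ u ⁻¹' Ici (v x)) ∩ Metric.closedBall x' R with hW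
  have hWc : IsCompact W := by
    refine Metric.isCompact_of_isClosed_isBounded ?_
      (Metric.isBounded_closedBall.subset inter_subset_right)
    exact (hcont.preimage_isClosed_of_isClosed isClosed_closure isClosed_Ici).inter
      Metric.isClosed_closedBall
  have hWΩ : W ⊆ Ω := by
    rintro z ⟨⟨hz1, hz2⟩, -⟩
    by_contra hz
    have : z ∈ frontier Ω := by
      rw [hop.frontier_eq]; exact ⟨hz1, hz⟩
    have h0 := hbd z this
    simp only [mem_preimage, mem_Ici] at hz2
    linarith
  have hxW : x ∈ W :=
    ⟨⟨subset_closure hx, hvu x hx hxR⟩, by rwa [mem_closedBall_iff_norm]⟩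
  have hucont : ∀ z ∈ Ω, ContinuousAt u z := fun z hz =>
    (hu.continuousOn.continuousAt (hop.mem_nhds hz))
  have hvcont : ∀ z ∈ Ω, ContinuousAt v z := by
    intro z hz
    have h1 := hucont z hz
    have h2 := hψcont z hz
    fun_prop
  obtain ⟨z, hzW, hzmax⟩ := hWc.exists_isMaxOn ⟨x, hxW⟩
    (fun w hw => (hvcont w (hWΩ hw)).continuousWithinAt)
  have hzΩ := hWΩ hzW
  have hvz : v x ≤ v z := hzmax hxW
  have hzR : ‖z - x'‖ < R := by
    refine lt_of_le_of_ne (mem_closedBall_iff_norm.1 hzW.2) fun h => ?_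
    have := hvR z hzΩ h
    linarith
  have hloc : IsLocalMax v z := by
    filter_upwards [hop.mem_nhds hzΩ, Metric.isOpen_ball.mem_nhds (mem_ball_iff_norm.2 hzR)]
      with w hwΩ hwR
    rw [mem_ball_iff_norm] at hwR
    by_cases hw : v x ≤ u w
    · exact hzmax ⟨⟨subset_closure hwΩ, hw⟩, mem_closedBall_iff_norm.2 hwR.le⟩
    · have := hvu w hwΩ hwR.le
      linarith
  obtain ⟨δ, hδ0, hδz⟩ := hδ z hzΩ
  have key : lap u z + 2 * A ≤ 0 := by
    refine lap_add_le_zero hop hu hzΩ (C := M / S / δ ^ 4) ?_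
    have hnear : ∀ e : R2, ∀ᶠ s : ℝ in 𝓝 0, v (z + s • e) ≤ v z := by
      intro e
      have : Tendsto (fun s : ℝ => z + s • e) (𝓝 0) (𝓝 z) := by
        have : ContinuousAt (fun s : ℝ => z + s • e) 0 := by fun_prop
        simpa [ContinuousAt] using this
      exact this.eventually hloc
    have hsmall : ∀ᶠ s : ℝ in 𝓝 0, |s| < δ := by
      filter_upwards [Metric.ball_mem_nhds (0 : ℝ) hδ0] with s hs
      simpa using hs
    filter_upwards [hnear (EuclideanSpace.single 0 1), hnear (EuclideanSpace.single 1 1),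
      hnear (-EuclideanSpace.single 0 1), hnear (-EuclideanSpace.single 1 1), hsmall]
      with s h1 h2 h3 h4 hs
    have hP := arcPotential_cross_le hy hr.le hs hδz
    have hN0 := norm_add_smul_sq_add (z - x') s 0
    have hN1 := norm_add_smul_sq_add (z - x') s 1
    rw [sub_add_eq_add_sub, sub_right_comm] at hN0 hN1
    simp only [smul_neg, ← sub_eq_add_neg, hv] at h1 h2 h3 h4
    simp only [Fin.sum_univ_two] at hP ⊢
    have hψs : 4 * ψ z - (s / δ) ^ 4
        ≤ ψ (z + s • EuclideanSpace.single 0 1) + ψ (z - s • EuclideanSpace.single 0 1)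
        + (ψ (z + s • EuclideanSpace.single 1 1) + ψ (z - s • EuclideanSpace.single 1 1)) := by
      have h5 := div_le_div_of_nonneg_right hP hr.le
      have h6 : (4 * arcPotential y r z + r * (s / δ) ^ 4) / r
          = 4 * (arcPotential y r z / r) + (s / δ) ^ 4 := by
        field_simp
      rw [h6] at h5
      simp only [add_div] at h5
      simp only [hψ]
      linarith
    have h7 := mul_le_mul_of_nonneg_left hψs hβ.le
    have h8 : M / S / δ ^ 4 * s ^ 4 = M / S * (s / δ) ^ 4 := by
      rw [div_pow]; ring
    have h9 := congrArg (fun q => A / 2 * q) hN0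
    have h10 := congrArg (fun q => A / 2 * q) hN1
    rw [h8]
    linarith
  have := hlap z hzΩ
  linarith

/-- Every boundary point starts a boundary arc of any small size `r`, contained in a ball of
comparable radius and projecting isometrically onto an interval of length `r`. -/
lemma exists_boundary_arc {Ω : Set R2} (hbdd : Bornology.IsBounded Ω) (hsm : SmoothBoundary Ω) :
    ∃ L : ℝ, 0 ≤ L ∧ ∃ r₀ > 0, ∀ x' ∈ frontier Ω, ∀ r, 0 < r → r ≤ r₀ →
      ∃ (y : ℝ → R2) (c : R2 → ℝ), Continuous y ∧ (∀ t ∈ Icc 0 r, y t ∈ frontier Ω) ∧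
        (∀ t ∈ Icc 0 r, ‖y t - x'‖ ≤ L * r) ∧ ∀ z t, |c z - t| ≤ ‖z - y t‖ := by
  have hcomp : IsCompact (frontier Ω) := Metric.isCompact_of_isClosed_isBounded isClosed_frontier
    (hbdd.closure.subset frontier_subset_closure)
  suffices h : ∃ L : ℝ, 0 ≤ L ∧ ∃ r₀ > 0, ∀ x' ∈ frontier Ω, x' ∈ frontier Ω →
      ∀ r, 0 < r → r ≤ r₀ →
      ∃ (y : ℝ → R2) (c : R2 → ℝ), Continuous y ∧ (∀ t ∈ Icc 0 r, y t ∈ frontier Ω) ∧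
        (∀ t ∈ Icc 0 r, ‖y t - x'‖ ≤ L * r) ∧ ∀ z t, |c z - t| ≤ ‖z - y t‖ by
    obtain ⟨L, hL, r₀, hr₀, h⟩ := h
    exact ⟨L, hL, r₀, hr₀, fun x' hx' => h x' hx' hx'⟩
  refine hcomp.induction_on (p := fun s => ∃ L : ℝ, 0 ≤ L ∧ ∃ r₀ > 0, ∀ x' ∈ s,
      x' ∈ frontier Ω → ∀ r, 0 < r → r ≤ r₀ →
      ∃ (y : ℝ → R2) (c : R2 → ℝ), Continuous y ∧ (∀ t ∈ Icc 0 r, y t ∈ frontier Ω) ∧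
        (∀ t ∈ Icc 0 r, ‖y t - x'‖ ≤ L * r) ∧ ∀ z t, |c z - t| ≤ ‖z - y t‖) ?_ ?_ ?_ ?_
  · exact ⟨0, le_rfl, 1, one_pos, by simp⟩
  · rintro s t hst ⟨L, hL, r₀, hr₀, h⟩
    exact ⟨L, hL, r₀, hr₀, fun x' hx' => h x' (hst hx')⟩
  · rintro s t ⟨L₁, hL₁, r₁, hr₁, h₁⟩ ⟨L₂, hL₂, r₂, hr₂, h₂⟩
    refine ⟨max L₁ L₂, le_max_of_le_left hL₁, min r₁ r₂, lt_min hr₁ hr₂, ?_⟩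
    rintro x' (hx' | hx') hf r hr hrr
    · obtain ⟨y, c, hy, hyf, hyL, hc⟩ := h₁ x' hx' hf r hr (hrr.trans (min_le_left _ _))
      exact ⟨y, c, hy, hyf, fun t ht => (hyL t ht).trans (by gcongr; exact le_max_left _ _), hc⟩
    · obtain ⟨y, c, hy, hyf, hyL, hc⟩ := h₂ x' hx' hf r hr (hrr.trans (min_le_right _ _))
      exact ⟨y, c, hy, hyf, fun t ht => (hyL t ht).trans (by gcongr; exact le_max_right _ _), hc⟩
  · intro x₀ hx₀
    obtain ⟨V, hV, hxV, e, g, hg, hgraph⟩ := hsm x₀ hx₀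
    obtain ⟨ρ, hρ, hρV⟩ := Metric.isOpen_iff.1 hV x₀ hxV
    obtain ⟨K, T, hT, hKT⟩ := ((hg.of_le (m := 1) (by exact_mod_cast le_top)).contDiffAt
      (x := e x₀ 0)).exists_lipschitzOnWith
    obtain ⟨η, hη, hηT⟩ := Metric.mem_nhds_iff.1 hT
    refine ⟨Metric.ball x₀ (min (ρ / 2) (η / 2)),
      mem_nhdsWithin_of_mem_nhds (Metric.ball_mem_nhds _ (by positivity)),
      1 + K, by positivity, min (η / 2) (ρ / 2 / (1 + K)), by positivity, ?_⟩
    intro x' hx' hf r hr hrr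
    have hx'ρ : dist x' x₀ < ρ / 2 := (mem_ball.1 hx').trans_le (min_le_left _ _)
    have hx'η : dist x' x₀ < η / 2 := (mem_ball.1 hx').trans_le (min_le_right _ _)
    have hrη : r ≤ η / 2 := hrr.trans (min_le_left _ _)
    have hrρ : (1 + K) * r ≤ ρ / 2 := by
      have := hrr.trans (min_le_right _ _)
      rw [le_div_iff₀ (by positivity)] at this
      linarith
    have habs : ∀ p q : R2, |e p 0 - e q 0| ≤ dist p q := by
      intro p q
      rw [← e.isometry.dist_eq, dist_eq_norm]
      exact PiLp.norm_apply_le (e p - e q) 0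
    have hx'V : x' ∈ V := hρV (by rw [mem_ball]; linarith)
    have hx'g : e x' 1 = g (e x' 0) := (hgraph.subset ⟨hf, hx'V⟩).2
    set a : ℝ := e x' 0 with ha
    have haη : |a - e x₀ 0| < η / 2 := (habs x' x₀).trans_lt hx'η
    set y : ℝ → R2 := fun t => e.symm !₂[a + t, g (a + t)] with hy
    have hey : ∀ t, e (y t) = !₂[a + t, g (a + t)] := fun t => e.apply_symm_apply _
    have hyx' : ∀ t ∈ Icc 0 r, dist (y t) x' ≤ (1 + K) * r := by
      intro t ht
      have h1 : dist (g (a + t)) (g a) ≤ K * dist (a + t) a := by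
        refine hKT.dist_le_mul _ (hηT ?_) _ (hηT ?_)
        · rw [mem_ball, Real.dist_eq]
          have := abs_add_le (a - e x₀ 0) t
          rw [abs_of_nonneg ht.1, sub_add_eq_add_sub] at this
          linarith [ht.2]
        · rw [mem_ball, Real.dist_eq]
          linarith
      rw [Real.dist_eq, Real.dist_eq, add_sub_cancel_left, abs_of_nonneg ht.1] at h1
      have h2 : (K : ℝ) * t ≤ K * r := by gcongr; exact ht.2
      rw [← e.isometry.dist_eq, hey, EuclideanSpace.dist_eq]
      simp only [Fin.sum_univ_two]
      refine Real.sqrt_le_iff.2 ⟨by positivity, ?_⟩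
      simp only [Matrix.cons_val_zero, Matrix.cons_val_one, hx'g, ← ha,
        Real.dist_eq, add_sub_cancel_left, sq_abs]
      have h3 : (g (a + t) - g a) ^ 2 ≤ (K * r) ^ 2 := by
        rw [← sq_abs]
        gcongr
        linarith
      have h4 : t ^ 2 ≤ r ^ 2 := by
        have := ht.1
        gcongr
        exact ht.2
      have h5 : 0 ≤ 2 * r * (K * r) := by positivity
      linarith
    refine ⟨y, fun z => e z 0 - a, ?_, ?_, ?_, ?_⟩
    · have := hg.continuous
      refine e.symm.continuous.comp ?_
      fun_prop
    · intro t ht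
      have hyV : y t ∈ V := by
        apply hρV
        rw [mem_ball]
        have := dist_triangle (y t) x' x₀
        have := hyx' t ht
        linarith
      have : y t ∈ frontier Ω ∩ V := by
        rw [hgraph]
        exact ⟨hyV, by simp [hey]⟩
      exact this.1
    · intro t ht
      rw [← dist_eq_norm]
      exact hyx' t ht
    · intro z t
      have := habs z (y t)
      rw [hey, dist_eq_norm] at this
      simpa [sub_sub] using this

/-- The scale-invariant lower bound for the distance from a maximum point to the boundary. -/
lemma exists_le_rpow_mul_infDist_sq {Ω : Set R2} (hne : Ω.Nonempty) (hop : IsOpen Ω)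
    (hbdd : Bornology.IsBounded Ω) (hsm : SmoothBoundary Ω) :
    ∃ κ > 0, ∀ (p : ℝ) (u : R2 → ℝ) (x : R2), 1 < p → IsSolution Ω p u → x ∈ Ω → 0 < u x →
      (∀ z ∈ Ω, |u z| ≤ u x) → κ ≤ u x ^ (p - 1) * infDist x (frontier Ω) ^ 2 := by
  have hcomp : IsCompact (frontier Ω) := Metric.isCompact_of_isClosed_isBounded isClosed_frontier
    (hbdd.closure.subset frontier_subset_closure)
  have hfne : (frontier Ω).Nonempty := by
    refine nonempty_frontier_iff.2 ⟨hne, fun h => ?_⟩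
    exact NormedSpace.unbounded_univ ℝ R2 (h ▸ hbdd)
  obtain ⟨L₀, hL₀, r₀, hr₀, harc⟩ := exists_boundary_arc hbdd hsm
  set D : ℝ := Metric.diam (closure Ω) with hD
  set L : ℝ := max (max L₀ 1) (D / r₀) with hL
  have hL₀L : L₀ ≤ L := (le_max_left _ _).trans (le_max_left _ _)
  have hL1 : 1 ≤ L := (le_max_right _ _).trans (le_max_left _ _)
  have hL0 : 0 ≤ L := zero_le_one.trans hL1
  have hlog : 0 ≤ Real.log (2 * L + 1) := Real.log_nonneg (by linarith)
  set S : ℝ := 3 + Real.log (2 * L + 1) with hS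
  set Q : ℝ := Real.exp 1 * (2 * L + 1) + L with hQ
  have hSpos : 0 < S := by positivity
  have hQpos : 0 < Q := by positivity
  refine ⟨2 / (S * Q ^ 2), by positivity, ?_⟩
  rintro p u x hp ⟨hC2, hC1, heq, hbd⟩ hx hM hmax
  obtain ⟨x', hx', hdist⟩ := hcomp.exists_infDist_eq_dist hfne x
  set M : ℝ := u x with hMdef
  set d : ℝ := infDist x (frontier Ω) with hd
  have hdpos : 0 < d := by
    rw [hdist, dist_pos]
    rintro rfl
    exact (hop.inter_frontier_eq ▸ (⟨hx, hx'⟩ : x ∈ Ω ∩ frontier Ω) : x ∈ (∅ : Set R2))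
  have hdD : d ≤ D := by
    rw [hdist]
    exact Metric.dist_le_diam_of_mem hbdd.closure (subset_closure hx)
      (frontier_subset_closure hx')
  set r : ℝ := min d r₀ with hr
  have hrpos : 0 < r := lt_min hdpos hr₀
  have hdr : d ≤ L * r := by
    rcases le_total d r₀ with h | h
    · rw [hr, min_eq_left h]
      exact le_mul_of_one_le_left hdpos.le hL1
    · rw [hr, min_eq_right h]
      have : D / r₀ ≤ L := le_max_right _ _
      rw [div_le_iff₀ hr₀] at this
      linarith
  obtain ⟨y, c, hy, hyf, hyL, hc⟩ := harc x' hx' r hrpos (min_le_right _ _)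
  have hApos : 0 < M ^ (p - 1) := Real.rpow_pos_of_pos hM _
  have hlap : ∀ z ∈ Ω, -lap u z ≤ M ^ (p - 1) * M := by
    intro z hz
    rw [heq z hz]
    have h1 : |u z| ^ (p - 1) ≤ M ^ (p - 1) :=
      Real.rpow_le_rpow (abs_nonneg _) (hmax z hz) (by linarith)
    have h2 : 0 ≤ |u z| ^ (p - 1) := Real.rpow_nonneg (abs_nonneg _) _
    calc |u z| ^ (p - 1) * u z ≤ |u z| ^ (p - 1) * M :=
          mul_le_mul_of_nonneg_left ((le_abs_self _).trans (hmax z hz)) h2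
      _ ≤ M ^ (p - 1) * M := mul_le_mul_of_nonneg_right h1 hM.le
  have hest := le_sub_of_boundary_arc hop hC1.continuousOn hC2 hbd (mul_pos hApos hM) hM hlap
    (fun z hz => (le_abs_self _).trans (hmax z hz)) hrpos hL0 hy hyf
    (fun t ht => (hyL t ht).trans (by gcongr)) hc hx
    (by rw [← dist_eq_norm, ← hdist]; exact hdr)
  rw [← hS, ← hQ, ← hMdef] at hest
  have h1 : M * (1 / S) ≤ M * (M ^ (p - 1) / 2 * (Q * r) ^ 2) := by
    have : M * (1 / S) = M / S := by ring
    linarith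
  have h2 := le_of_mul_le_mul_left h1 hM
  have h3 : 2 / (S * Q ^ 2) ≤ M ^ (p - 1) * r ^ 2 := by
    have h4 : 2 / (S * Q ^ 2) = 1 / S * (2 / Q ^ 2) := by
      field_simp
    have h5 : M ^ (p - 1) * r ^ 2 = M ^ (p - 1) / 2 * (Q * r) ^ 2 * (2 / Q ^ 2) := by
      field_simp
    rw [h4, h5]
    gcongr
  refine h3.trans ?_
  gcongr
  exact min_le_left _ _

theorem stmt6
    (Ω : Set R2) (hne : Ω.Nonempty) (hop : IsOpen Ω)
    (hbdd : Bornology.IsBounded Ω) (hconn : IsConnected Ω) (hsm : SmoothBoundary Ω)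
    (u : ℝ → R2 → ℝ)
    (hsol : ∀ p > (1:ℝ), IsSolution Ω p (u p))
    (hnod : ∀ p > (1:ℝ), IsNodal Ω (u p))
    (xp xm : ℝ → R2)
    (hxpmem : ∀ p > (1:ℝ), xp p ∈ Ω)
    (hxpmax : ∀ p > (1:ℝ), ∀ x ∈ Ω, u p x ≤ u p (xp p))
    (hxmmem : ∀ p > (1:ℝ), xm p ∈ Ω)
    (hxmmin : ∀ p > (1:ℝ), ∀ x ∈ Ω, u p (xm p) ≤ u p x)
    (hcomp : ∀ p > (1:ℝ), -u p (xm p) ≤ u p (xp p))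
    (hA : CondA Ω u) :
    Tendsto (fun p : ℝ => Metric.infDist (xp p) (frontier Ω) / eps u xp p) atTop atTop := by
  obtain ⟨κ, hκ, hbound⟩ := exists_le_rpow_mul_infDist_sq hne hop hbdd hsm
  have hlim : Tendsto (fun p : ℝ => Real.sqrt (p * κ)) atTop atTop :=
    Real.tendsto_sqrt_atTop.comp (tendsto_id.atTop_mul_const hκ)
  refine tendsto_atTop_mono' atTop ?_ hlim
  filter_upwards [eventually_gt_atTop (1 : ℝ)] with p hp
  have hM : 0 < u p (xp p) := by
    obtain ⟨x, hx, hpos⟩ := (hnod p hp).1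
    exact hpos.trans_le (hxpmax p hp x hx)
  have h := hbound p (u p) (xp p) hp (hsol p hp) (hxpmem p hp) hM fun z hz =>
    abs_le.2 ⟨by linarith [hxmmin p hp z hz, hcomp p hp], hxpmax p hp z hz⟩
  have hd : 0 ≤ infDist (xp p) (frontier Ω) := infDist_nonneg
  rw [eps, div_div_eq_mul_div, div_one]
  refine Real.sqrt_le_iff.2 ⟨by positivity, ?_⟩
  have hp0 : 0 < p := by linarith
  have hA : 0 < u p (xp p) ^ (p - 1) := Real.rpow_pos_of_pos hM _
  rw [mul_pow, Real.sq_sqrt (by positivity)]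
  calc p * κ ≤ p * (u p (xp p) ^ (p - 1) * infDist (xp p) (frontier Ω) ^ 2) := by gcongr
    _ = _ := by ring
end
end
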